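/- arXiv:1809.02998 — 4 statements merged into one kernel-verified Lean document; each statement's English description precedes it below -/
import Mathlib

section
/- (Existence of profiles for (M2), Case C1, Theorem 3.2.) Assume κ⁻ > κ⁺ > 0 and let ρ⁻, ρ⁺ ∈ (0,1) satisfy ρ⁻ < ρ̂ < ρ⁺ and f̄ := κ⁻ρ⁻v(ρ⁻) = κ⁺ρ⁺v(ρ⁺) > 0. Then the set of functions P : ℝ → [0,1] with the following properties is infinite: P is continuous on ℝ and monotone nondecreasing; P(x) · ∫₀^h κ(x+s)·v(P(x+s))·w(s) ds = f̄ for all x ∈ ℝ; lim_{x→−∞} P(x) = ρ⁻ and lim_{x→+∞} P(x) = ρ⁺. Moreover, every such profile fails to be differentiable at x = 0. -/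
open Set Filter Topology MeasureTheory

/-- The rough road coefficient `κ(x) = κ⁻` for `x < 0`, `κ(x) = κ⁺` for `x > 0`. -/
noncomputable def kappa (km kp : ℝ) (x : ℝ) : ℝ := if x < 0 then km else kp

/-- The averaged velocity of model (M2):
`V(x) = ∫₀ʰ κ(x+s)·v(P(x+s))·w(s) ds`. -/
noncomputable def avgVel (h : ℝ) (w v : ℝ → ℝ) (km kp : ℝ) (P : ℝ → ℝ) (x : ℝ) : ℝ :=
  ∫ s in (0:ℝ)..h, kappa km kp (x + s) * v (P (x + s)) * w s

/-- A stationary profile for model (M2): continuous `P : ℝ → [0,1]` with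
`P(x)·V(x) = f̄` for all `x`, and limits `ρ⁻` at `−∞`, `ρ⁺` at `+∞`. -/
def IsProfileM2 (h : ℝ) (w v : ℝ → ℝ) (km kp fbar rhom rhop : ℝ) (P : ℝ → ℝ) : Prop :=
  Continuous P ∧ (∀ x, P x ∈ Set.Icc (0:ℝ) 1) ∧
  (∀ x, P x * avgVel h w v km kp P x = fbar) ∧
  Filter.Tendsto P Filter.atBot (nhds rhom) ∧ Filter.Tendsto P Filter.atTop (nhds rhop)
/-- The look-ahead kernel `w`, viewed as a measure on `(0, h)`. -/
noncomputable def kernelMeasure (h : ℝ) (w : ℝ → ℝ) : Measure ℝ :=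
  (volume.restrict (Ioo 0 h)).withDensity fun s => ENNReal.ofReal (w s)

lemma kernelMeasure_absolutelyContinuous (h : ℝ) (w : ℝ → ℝ) :
    kernelMeasure h w ≪ volume :=
  (withDensity_absolutelyContinuous _ _).trans Measure.absolutelyContinuous_restrict

lemma ae_mem_Ioo_kernelMeasure (h : ℝ) (w : ℝ → ℝ) :
    ∀ᵐ s ∂kernelMeasure h w, s ∈ Ioo 0 h :=
  (withDensity_absolutelyContinuous _ _).ae_le (ae_restrict_mem measurableSet_Ioo)

lemma integral_kernelMeasure {h : ℝ} (hh : 0 < h) {w : ℝ → ℝ}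
    (hw_cont : ContinuousOn w (Ioo 0 h)) (hw_pos : ∀ x ∈ Ioo 0 h, 0 < w x) (f : ℝ → ℝ) :
    ∫ s, f s ∂kernelMeasure h w = ∫ s in (0 : ℝ)..h, f s * w s := by
  have hm : AEMeasurable (fun s => ENNReal.ofReal (w s)) (volume.restrict (Ioo 0 h)) :=
    (hw_cont.aemeasurable measurableSet_Ioo).ennreal_ofReal
  rw [kernelMeasure, integral_withDensity_eq_integral_toReal_smul₀ hm (by simp),
    intervalIntegral.integral_of_le hh.le, integral_Ioc_eq_integral_Ioo]
  refine setIntegral_congr_fun measurableSet_Ioo fun s hs => ?_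
  simp only [smul_eq_mul]
  rw [ENNReal.toReal_ofReal (hw_pos s hs).le, mul_comm]

lemma isProbabilityMeasure_kernelMeasure {h : ℝ} (hh : 0 < h) {w : ℝ → ℝ}
    (hw_cont : ContinuousOn w (Ioo 0 h)) (hw_pos : ∀ x ∈ Ioo 0 h, 0 < w x)
    (hw_int : ∫ s in (0 : ℝ)..h, w s = 1) :
    IsProbabilityMeasure (kernelMeasure h w) := by
  have hI := integral_kernelMeasure hh hw_cont hw_pos fun _ => 1
  simp only [one_mul, hw_int, integral_const, smul_eq_mul, mul_one] at hI
  refine ⟨?_⟩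
  rw [measureReal_def] at hI
  rwa [ENNReal.toReal_eq_one_iff] at hI

section Average

variable {μ : Measure ℝ} [IsProbabilityMeasure μ] {h : ℝ}

lemma integrable_of_mem_Icc {f : ℝ → ℝ} {a b : ℝ} (hf : Measurable f)
    (hab : ∀ᵐ s ∂μ, f s ∈ Icc a b) : Integrable f μ :=
  Integrable.of_mem_Icc a b hf.aemeasurable hab

lemma integrable_exp_neg (hμ : ∀ᵐ s ∂μ, s ∈ Ioo 0 h) {l : ℝ} (hl : 0 ≤ l) :
    Integrable (fun s => Real.exp (-l * s)) μ := by
  refine integrable_of_mem_Icc (a := 0) (b := 1) (by fun_prop) ?_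
  filter_upwards [hμ] with s hs
  exact ⟨(Real.exp_pos _).le, Real.exp_le_one_iff.2 (by nlinarith [hs.1])⟩

lemma continuousOn_laplace (hμ : ∀ᵐ s ∂μ, s ∈ Ioo 0 h) :
    ContinuousOn (fun l : ℝ => ∫ s, Real.exp (-l * s) ∂μ) (Ici 0) := by
  refine continuousOn_of_dominated (bound := fun _ => 1) (fun l _ => by fun_prop) ?_
    (integrable_const _) (ae_of_all _ fun s => by fun_prop)
  intro l hl
  filter_upwards [hμ] with s hs
  rw [Real.norm_of_nonneg (Real.exp_pos _).le]
  exact Real.exp_le_one_iff.2 (by nlinarith [hs.1, mem_Ici.1 hl])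

lemma tendsto_laplace_atTop (hμ : ∀ᵐ s ∂μ, s ∈ Ioo 0 h) :
    Tendsto (fun l : ℝ => ∫ s, Real.exp (-l * s) ∂μ) atTop (𝓝 0) := by
  have : Tendsto (fun l : ℝ => ∫ s, Real.exp (-l * s) ∂μ) atTop (𝓝 (∫ _, (0 : ℝ) ∂μ)) := by
    refine tendsto_integral_filter_of_dominated_convergence (fun _ => 1)
      (Eventually.of_forall fun l => by fun_prop) ?_ (integrable_const _) ?_
    · filter_upwards [eventually_ge_atTop 0] with l hl
      filter_upwards [hμ] with s hs
      rw [Real.norm_of_nonneg (Real.exp_pos _).le]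
      exact Real.exp_le_one_iff.2 (by nlinarith [hs.1])
    · filter_upwards [hμ] with s hs
      refine Real.tendsto_exp_atBot.comp ?_
      exact (tendsto_neg_atTop_atBot).atBot_mul_const hs.1
  simpa using this

lemma exists_laplace_eq (hμ : ∀ᵐ s ∂μ, s ∈ Ioo 0 h) {y : ℝ} (hy0 : 0 < y) (hy1 : y < 1) :
    ∃ l > 0, ∫ s, Real.exp (-l * s) ∂μ = y := by
  obtain ⟨L, hLy, hL⟩ := (((tendsto_laplace_atTop hμ).eventually (gt_mem_nhds hy0)).and
    (eventually_ge_atTop 0)).exists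
  have hiv := intermediate_value_Icc' hL ((continuousOn_laplace hμ).mono Icc_subset_Ici_self)
  obtain ⟨l, hl, hly⟩ := hiv ⟨hLy.le, by simpa using hy1.le⟩
  refine ⟨l, lt_of_le_of_ne hl.1 ?_, hly⟩
  rintro rfl
  simp at hly
  linarith

lemma laplace_two_mul_lt (hμ : ∀ᵐ s ∂μ, s ∈ Ioo 0 h) {l : ℝ} (hl : 0 < l) :
    ∫ s, Real.exp (-(2 * l) * s) ∂μ < ∫ s, Real.exp (-l * s) ∂μ := by
  have hi1 := integrable_exp_neg hμ (l := 2 * l) (by positivity)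
  have hi2 := integrable_exp_neg hμ hl.le
  have hlt : ∀ᵐ s ∂μ, Real.exp (-(2 * l) * s) < Real.exp (-l * s) := by
    filter_upwards [hμ] with s hs
    exact Real.exp_lt_exp.2 (by nlinarith [mul_pos hl hs.1])
  refine lt_of_le_of_ne (integral_mono_ae hi1 hi2 (hlt.mono fun s hs => hs.le)) fun heq => ?_
  have h0 := (integral_eq_iff_of_ae_le hi1 hi2 (hlt.mono fun s hs => hs.le)).1 heq
  obtain ⟨s, hs1, hs2⟩ := (hlt.and h0).exists
  exact hs1.ne hs2

end Average

/-- Averaging an antitone bounded function against a bounded kernel gives a Lipschitz function. -/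
lemma lipschitzWith_average {h : ℝ} (hh : 0 < h) {w : ℝ → ℝ}
    (hw_cont : ContinuousOn w (Ioo 0 h)) (hw_pos : ∀ x ∈ Ioo 0 h, 0 < w x)
    (hw_int : ∫ s in (0 : ℝ)..h, w s = 1) {C : ℝ} (hC : ∀ x, w x ≤ C)
    {f : ℝ → ℝ} (hf : Antitone f) {B : ℝ} (hB : ∀ x, f x ∈ Icc 0 B) :
    LipschitzWith (C * B).toNNReal fun x => ∫ s, f (x + s) ∂kernelMeasure h w := by
  have hprob := isProbabilityMeasure_kernelMeasure hh hw_cont hw_pos hw_int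
  have hC0 : 0 ≤ C := (hw_pos (h / 2) ⟨by linarith, by linarith⟩).le.trans (hC _)
  have hB0 : 0 ≤ B := (hB 0).1.trans (hB 0).2
  have hint : ∀ x, Integrable (fun s => f (x + s)) (kernelMeasure h w) := fun x =>
    integrable_of_mem_Icc (a := 0) (b := B) (hf.measurable.comp (measurable_const_add x))
      (ae_of_all _ fun s => hB _)
  have hii : ∀ a b x, IntervalIntegrable (fun s => f (x + s)) volume a b := fun a b x =>
    (hf.comp_monotone fun a b hab => by simpa using hab).intervalIntegrable
  have hw_ii : IntervalIntegrable w volume 0 h := by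
    by_contra hn
    rw [intervalIntegral.integral_undef hn] at hw_int
    exact zero_ne_one hw_int
  have key : ∀ x y, x ≤ y → (∫ s, f (x + s) ∂kernelMeasure h w)
      - ∫ s, f (y + s) ∂kernelMeasure h w ≤ C * B * (y - x) := by
    intro x y hxy
    have hfw : ∀ z, IntervalIntegrable (fun s => f (z + s) * w s) volume 0 h := by
      intro z
      refine ⟨?_, by simp [hh.le]⟩
      refine hw_ii.1.bdd_mul (c := B)
        (hf.measurable.comp (measurable_const_add z)).aestronglyMeasurable ?_
      refine ae_of_all _ fun s => ?_
      rw [Real.norm_of_nonneg (hB _).1]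
      exact (hB _).2
    calc (∫ s, f (x + s) ∂kernelMeasure h w) - ∫ s, f (y + s) ∂kernelMeasure h w
        = ∫ s in (0 : ℝ)..h, (f (x + s) - f (y + s)) * w s := by
          rw [integral_kernelMeasure hh hw_cont hw_pos, integral_kernelMeasure hh hw_cont hw_pos,
            ← intervalIntegral.integral_sub (hfw x) (hfw y)]
          simp only [sub_mul]
      _ ≤ ∫ s in (0 : ℝ)..h, (f (x + s) - f (y + s)) * C := by
          refine intervalIntegral.integral_mono_on hh.le ?_
            (((hii _ _ x).sub (hii _ _ y)).mul_const _) fun s _ => ?_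
          · simpa only [sub_mul] using (hfw x).sub (hfw y)
          · exact mul_le_mul_of_nonneg_left (hC s) (sub_nonneg.2 (hf (by linarith)))
      _ = C * ((∫ s in x..x + h, f s) - ∫ s in y..y + h, f s) := by
          rw [intervalIntegral.integral_mul_const, intervalIntegral.integral_sub (hii _ _ x) (hii _ _ y),
            intervalIntegral.integral_comp_add_left, intervalIntegral.integral_comp_add_left,
            add_zero, add_zero, mul_comm]
      _ = C * ((∫ s in x..y, f s) - ∫ s in (x + h)..(y + h), f s) := by
          have hi : ∀ a b, IntervalIntegrable f volume a b := fun a b => hf.intervalIntegrable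
          have h1 := intervalIntegral.integral_add_adjacent_intervals (hi x y) (hi y (y + h))
          have h2 := intervalIntegral.integral_add_adjacent_intervals (hi x (x + h)) (hi (x + h) (y + h))
          congr 1
          linarith
      _ ≤ C * (B * (y - x)) := by
          have h1 : ∫ s in x..y, f s ≤ ∫ _ in x..y, B :=
            intervalIntegral.integral_mono_on hxy hf.intervalIntegrable (by simp) fun s _ => (hB s).2
          have h2 : 0 ≤ ∫ s in (x + h)..(y + h), f s :=
            intervalIntegral.integral_nonneg (by linarith) fun s _ => (hB s).1
          rw [intervalIntegral.integral_const, smul_eq_mul] at h1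
          refine mul_le_mul_of_nonneg_left ?_ hC0
          linarith
      _ = C * B * (y - x) := by ring
  refine LipschitzWith.of_le_add_mul _ fun x y => ?_
  rw [Real.coe_toNNReal _ (by positivity), Real.dist_eq]
  rcases le_total x y with hxy | hxy
  · have := key x y hxy
    rw [abs_sub_comm, abs_of_nonneg (by linarith : 0 ≤ y - x)]
    linarith
  · have : (∫ s, f (x + s) ∂kernelMeasure h w) ≤ ∫ s, f (y + s) ∂kernelMeasure h w :=
      integral_mono (hint x) (hint y) fun s => hf (by linarith)
    have h2 : 0 ≤ C * B * |x - y| := by positivity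
    linarith

/-- Tarski-type fixed points for order-preserving operators on monotone real functions lying
between two barriers. -/
lemma exists_fixedPoint_between {T : (ℝ → ℝ) → ℝ → ℝ} {lo hi : ℝ → ℝ}
    (hlo : Monotone lo) (hlohi : lo ≤ hi) (hlo_sub : lo ≤ T lo)
    (hT_mono : ∀ P, Monotone P → lo ≤ P → P ≤ hi → Monotone (T P))
    (hT_le : ∀ P Q, Monotone P → lo ≤ P → P ≤ hi → Monotone Q → lo ≤ Q → Q ≤ hi → P ≤ Q →
      T P ≤ T Q)
    (hT_hi : ∀ P, Monotone P → lo ≤ P → P ≤ hi → T P ≤ hi) :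
    ∃ P, Monotone P ∧ lo ≤ P ∧ P ≤ hi ∧ T P = P := by
  set S : Set (ℝ → ℝ) := {P | Monotone P ∧ lo ≤ P ∧ P ≤ hi ∧ P ≤ T P} with hS
  have hloS : lo ∈ S := ⟨hlo, le_rfl, hlohi, hlo_sub⟩
  have hbdd : BddAbove S := ⟨hi, fun P hP => hP.2.2.1⟩
  have hne : S.Nonempty := ⟨lo, hloS⟩
  have hlub : IsLUB S (sSup S) := isLUB_csSup hne hbdd
  have hm : Monotone (sSup S) := by
    intro x y hxy
    have : sSup S ≤ fun z => sSup S (z + (y - x)) := by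
      refine hlub.2 fun P hP z => ?_
      exact (hP.1 (by linarith : z ≤ z + (y - x))).trans (hlub.1 hP _)
    simpa using this x
  have h1 : lo ≤ sSup S := hlub.1 hloS
  have h2 : sSup S ≤ hi := hlub.2 fun P hP => hP.2.2.1
  have h3 : sSup S ≤ T (sSup S) := hlub.2 fun P hP => hP.2.2.2.trans
    (hT_le _ _ hP.1 hP.2.1 hP.2.2.1 hm h1 h2 (hlub.1 hP))
  have hm' := hT_mono _ hm h1 h2
  have h2' := hT_hi _ hm h1 h2
  have h1' := h1.trans h3
  have h4 : T (sSup S) ≤ sSup S :=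
    hlub.1 ⟨hm', h1', h2', hT_le _ _ hm h1 h2 hm' h1' h2' h3⟩
  exact ⟨_, hm, h1, h2, h4.antisymm h3⟩

/-- The local speed `κ(y) v(P(y))`. -/
noncomputable def localSpeed (km kp : ℝ) (v P : ℝ → ℝ) (y : ℝ) : ℝ :=
  kappa km kp y * v (P y)

lemma kappa_mem_Icc {km kp : ℝ} (hk : kp ≤ km) (y : ℝ) : kappa km kp y ∈ Icc kp km := by
  unfold kappa
  split_ifs
  · exact ⟨hk, le_rfl⟩
  · exact ⟨le_rfl, hk⟩

lemma kappa_antitone {km kp : ℝ} (hk : kp ≤ km) : Antitone (kappa km kp) := by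
  intro x y hxy
  unfold kappa
  split_ifs with h1 h2 h2
  · rfl
  · linarith
  · exact hk
  · rfl

lemma kappa_of_nonneg {km kp y : ℝ} (hy : 0 ≤ y) : kappa km kp y = kp := by
  simp [kappa, hy]

lemma kappa_of_neg {km kp y : ℝ} (hy : y < 0) : kappa km kp y = km := by
  simp [kappa, hy]

section Speed

variable {km kp : ℝ} {v P Q : ℝ → ℝ}

lemma mem_Icc_of_antitoneOn (hv : AntitoneOn v (Icc 0 1)) (hv0 : v 0 = 1) (hv1 : v 1 = 0)
    {r : ℝ} (hr : r ∈ Icc (0 : ℝ) 1) : v r ∈ Icc (0 : ℝ) 1 :=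
  ⟨hv1 ▸ hv hr (right_mem_Icc.2 zero_le_one) hr.2, hv0 ▸ hv (left_mem_Icc.2 zero_le_one) hr hr.1⟩

lemma localSpeed_mem_Icc (hkp : 0 < kp) (hk : kp ≤ km) (hv : AntitoneOn v (Icc 0 1))
    (hv0 : v 0 = 1) (hv1 : v 1 = 0) {y : ℝ} (hP : P y ∈ Icc (0 : ℝ) 1) :
    localSpeed km kp v P y ∈ Icc 0 km := by
  have h1 := kappa_mem_Icc hk y
  have h2 := mem_Icc_of_antitoneOn hv hv0 hv1 hP
  exact ⟨mul_nonneg (hkp.le.trans h1.1) h2.1,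
    (mul_le_mul h1.2 h2.2 h2.1 (hkp.le.trans hk)).trans_eq (mul_one _)⟩

lemma localSpeed_antitone (hkp : 0 < kp) (hk : kp ≤ km) (hv : AntitoneOn v (Icc 0 1))
    (hv0 : v 0 = 1) (hv1 : v 1 = 0) (hPm : Monotone P) (hP : ∀ y, P y ∈ Icc (0 : ℝ) 1) :
    Antitone (localSpeed km kp v P) := fun x y hxy =>
  mul_le_mul (kappa_antitone hk hxy) (hv (hP x) (hP y) (hPm hxy))
    (mem_Icc_of_antitoneOn hv hv0 hv1 (hP y)).1 (hkp.le.trans (kappa_mem_Icc hk x).1)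

lemma localSpeed_le_localSpeed (hkp : 0 < kp) (hk : kp ≤ km) (hv : AntitoneOn v (Icc 0 1))
    {y : ℝ} (hP : P y ∈ Icc (0 : ℝ) 1) (hQ : Q y ∈ Icc (0 : ℝ) 1) (hPQ : P y ≤ Q y) :
    localSpeed km kp v Q y ≤ localSpeed km kp v P y :=
  mul_le_mul_of_nonneg_left (hv hP hQ hPQ) (hkp.le.trans (kappa_mem_Icc hk y).1)

lemma integrable_localSpeed {μ : Measure ℝ} [IsProbabilityMeasure μ]
    (hkp : 0 < kp) (hk : kp ≤ km) (hv : AntitoneOn v (Icc 0 1))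
    (hv0 : v 0 = 1) (hv1 : v 1 = 0) (hPm : Monotone P) (hP : ∀ y, P y ∈ Icc (0 : ℝ) 1) (x : ℝ) :
    Integrable (fun s => localSpeed km kp v P (x + s)) μ :=
  integrable_of_mem_Icc
    ((localSpeed_antitone hkp hk hv hv0 hv1 hPm hP).measurable.comp (measurable_const_add x))
    (ae_of_all _ fun _ => localSpeed_mem_Icc hkp hk hv hv0 hv1 (hP _))

end Speed

set_option maxHeartbeats 1000000 in
/-- Near the downstream state `p`, with `u = v p` and `a = -v' p`, the stationary equation admits
for each large amplitude `c` a monotone solution asymptotic to `p - c exp (-l x)`. -/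
lemma exists_monotone_solution {μ : Measure ℝ} [IsProbabilityMeasure μ] {h : ℝ}
    (hμ : ∀ᵐ s ∂μ, s ∈ Ioo 0 h) {km kp : ℝ} (hkp : 0 < kp) (hk : kp ≤ km) {v : ℝ → ℝ}
    (hv : AntitoneOn v (Icc 0 1)) (hv0 : v 0 = 1) (hv1 : v 1 = 0)
    {r p u a M l K : ℝ} (hr : 0 < r) (hrp : r < p) (hp : p < 1) (hu : 0 < u) (hup : v p = u)
    (ha : 0 < a) (hM : 0 ≤ M)
    (hrv : km * (r * v r) = kp * (p * u))
    (htan : ∀ y ∈ Icc r p, v y ≤ u + a * (p - y))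
    (htay : ∀ y ∈ Icc r p, u + a * (p - y) - M * (p - y) ^ 2 ≤ v y)
    (hl : 0 < l) {b : ℝ} (hlu : a * p * ∫ s, Real.exp (-l * s) ∂μ = u)
    (hlb : ∫ s, Real.exp (-(2 * l) * s) ∂μ = b)
    (hK0 : 0 < K) (hK1 : 1 ≤ K * (p - r))
    (hK2 : u / p ≤ r * ((u / p - a * b) * K - M * b))
    {c : ℝ} (hc : p - r ≤ c) :
    ∃ P : ℝ → ℝ, Monotone P ∧ (∀ x, P x ∈ Icc r p) ∧
      (∀ x, P x * ∫ s, localSpeed km kp v P (x + s) ∂μ = kp * (p * u)) ∧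
      (∀ x, p - c * Real.exp (-l * x) ≤ P x) ∧
      ∀ x, P x ≤ p - c * Real.exp (-l * x) + K * c ^ 2 * Real.exp (-l * x) ^ 2 := by
  have hp0 : 0 < p := hr.trans hrp
  have hc0 : 0 < c := by linarith
  have hsub : Icc r p ⊆ Icc 0 1 := Icc_subset_Icc hr.le hp.le
  set E : ℝ → ℝ := fun x => Real.exp (-l * x) with hE
  have hE0 : ∀ x, 0 < E x := fun x => Real.exp_pos _
  have hEadd : ∀ x s, E (x + s) = E x * E s := fun x s => by
    simp only [hE]
    rw [← Real.exp_add]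
    ring_nf
  have hEsq : ∀ s, E s ^ 2 = Real.exp (-(2 * l) * s) := fun s => by
    simp only [hE]
    rw [← Real.exp_nat_mul]
    push_cast
    ring_nf
  have hEanti : Antitone E := fun x y hxy => Real.exp_le_exp.2 (by nlinarith)
  have hE_int : Integrable E μ := integrable_exp_neg hμ hl.le
  have hE2_int : Integrable (fun s => E s ^ 2) μ := by
    simp only [hEsq]
    exact integrable_exp_neg hμ (by positivity)
  have hIE : ∫ s, E s ∂μ = u / (a * p) := by
    rw [eq_div_iff (by positivity), mul_comm]
    exact hlu
  have hIE2 : ∫ s, E s ^ 2 ∂μ = b := by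
    simp only [hEsq]
    exact hlb
  set lo : ℝ → ℝ := fun x => max r (p - c * E x) with hlo
  set hi : ℝ → ℝ := fun x => min p (p - c * E x + K * c ^ 2 * E x ^ 2) with hhi
  set V : (ℝ → ℝ) → ℝ → ℝ := fun P x => ∫ s, localSpeed km kp v P (x + s) ∂μ with hV
  have hKc : 1 ≤ K * c := hK1.trans (mul_le_mul_of_nonneg_left hc hK0.le)
  have hquad : ∀ z, c * z - K * c ^ 2 * z ^ 2 ≤ p - r := fun z => by
    have h1 : 0 ≤ K * (p - r) * (K * (p - r) - 1) :=
      mul_nonneg (by linarith) (by linarith)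
    have h2 : K * (c * z - K * c ^ 2 * z ^ 2) ≤ K * (p - r) := by
      nlinarith [sq_nonneg (2 * (K * c * z) - 1)]
    exact le_of_mul_le_mul_left h2 hK0
  have hlo_mono : Monotone lo := fun x y hxy =>
    max_le_max le_rfl (by linarith [mul_le_mul_of_nonneg_left (hEanti hxy) hc0.le])
  have hlohi : lo ≤ hi := fun x => by
    refine max_le (le_min hrp.le ?_) (le_min ?_ ?_)
    · linarith [hquad (E x)]
    · nlinarith [hE0 x]
    · have : 0 ≤ K * c ^ 2 * E x ^ 2 := by positivity
      linarith
  have hmem : ∀ P, lo ≤ P → P ≤ hi → ∀ x, P x ∈ Icc r p := fun P h1 h2 x =>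
    ⟨(le_max_left _ _).trans (h1 x), (h2 x).trans (min_le_left _ _)⟩
  have hint : ∀ P, Monotone P → lo ≤ P → P ≤ hi → ∀ x,
      Integrable (fun s => localSpeed km kp v P (x + s)) μ := fun P hPm h1 h2 x =>
    integrable_localSpeed hkp hk hv hv0 hv1 hPm (fun y => hsub (hmem P h1 h2 y)) x
  have hVpos : ∀ P, Monotone P → lo ≤ P → P ≤ hi → ∀ x, kp * u ≤ V P x := by
    intro P hPm h1 h2 x
    have : ∫ _, kp * u ∂μ ≤ V P x := by
      refine integral_mono (integrable_const _) (hint P hPm h1 h2 x) fun s => ?_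
      refine mul_le_mul (kappa_mem_Icc hk _).1 ?_ hu.le (hkp.le.trans (kappa_mem_Icc hk _).1)
      have hm := hmem P h1 h2 (x + s)
      exact hup ▸ hv (hsub hm) ⟨hp0.le, hp.le⟩ hm.2
    simpa using this
  have hkpu : 0 < kp * u := mul_pos hkp hu
  have hVpos' : ∀ P, Monotone P → lo ≤ P → P ≤ hi → ∀ x, 0 < V P x := fun P hPm h1 h2 x =>
    hkpu.trans_le (hVpos P hPm h1 h2 x)
  have hVE : ∀ x A B, ∫ s, kp * (u + A * E (x + s) - B * E (x + s) ^ 2) ∂μ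
      = kp * (u + A * (u / (a * p)) * E x - B * b * E x ^ 2) := by
    intro x A B
    have : ∀ s, kp * (u + A * E (x + s) - B * E (x + s) ^ 2)
        = kp * u + kp * A * E x * E s - kp * B * E x ^ 2 * E s ^ 2 := fun s => by
      rw [hEadd]; ring
    have hi1 : Integrable (fun s => kp * u + kp * A * E x * E s) μ :=
      (integrable_const _).add (hE_int.const_mul _)
    simp only [this]
    rw [integral_sub hi1 (hE2_int.const_mul _),
      integral_add (integrable_const _) (hE_int.const_mul _), integral_const_mul _ E,
      integral_const_mul _ (fun s => E s ^ 2), hIE, hIE2]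
    simp only [integral_const, probReal_univ, one_smul]
    ring
  have hVE_int : ∀ x A B, Integrable (fun s => kp * (u + A * E (x + s) - B * E (x + s) ^ 2)) μ := by
    intro x A B
    have : (fun s => kp * (u + A * E (x + s) - B * E (x + s) ^ 2))
        = fun s => kp * u + kp * A * E x * E s - kp * B * E x ^ 2 * E s ^ 2 := funext fun s => by
      rw [hEadd]; ring
    rw [this]
    exact ((integrable_const _).add (hE_int.const_mul _)).sub (hE2_int.const_mul _)
  have hap : a * (u / (a * p)) = u / p := by field_simp
  have hex : ∃ P, Monotone P ∧ lo ≤ P ∧ P ≤ hi ∧ (fun x => kp * (p * u) / V P x) = P := by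
    refine exists_fixedPoint_between (T := fun P x => kp * (p * u) / V P x)
      hlo_mono hlohi ?_ ?_ ?_ ?_
    · intro x
      have hpos := hVpos' lo hlo_mono le_rfl hlohi x
      simp only
      rw [le_div_iff₀ hpos]
      have hr_le : r * V lo x ≤ kp * (p * u) := by
        have : V lo x ≤ ∫ _, km * v r ∂μ := by
          refine integral_mono (hint lo hlo_mono le_rfl hlohi x) (integrable_const _) fun s => ?_
          have hm := hmem lo le_rfl hlohi (x + s)
          exact mul_le_mul (kappa_mem_Icc hk _).2 (hv ⟨hr.le, (hrp.trans hp).le⟩ (hsub hm) hm.1)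
            (mem_Icc_of_antitoneOn hv hv0 hv1 (hsub hm)).1 (hkp.le.trans hk)
        simp only [integral_const, probReal_univ, one_smul] at this
        calc r * V lo x ≤ r * (km * v r) := mul_le_mul_of_nonneg_left this hr.le
          _ = kp * (p * u) := by rw [← hrv]; ring
      rcases le_total (p - c * E x) r with hle | hle
      · rwa [show lo x = r from max_eq_left hle]
      rw [show lo x = p - c * E x from max_eq_right hle]
      have hx : 0 ≤ x := by
        by_contra! hneg
        have h1 : 1 < E x := Real.one_lt_exp_iff.2 (by nlinarith)
        nlinarith
      have hVle : V lo x ≤ kp * (u + u / p * (c * E x)) := by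
        calc V lo x ≤ ∫ s, kp * (u + a * c * E (x + s) - 0 * E (x + s) ^ 2) ∂μ := by
              refine integral_mono_ae (hint lo hlo_mono le_rfl hlohi x) (hVE_int x _ _) ?_
              filter_upwards [hμ] with s hs
              have hm := hmem lo le_rfl hlohi (x + s)
              simp only [localSpeed]
              rw [kappa_of_nonneg (by linarith [hs.1])]
              refine mul_le_mul_of_nonneg_left ((htan _ hm).trans ?_) hkp.le
              have : p - lo (x + s) ≤ c * E (x + s) := by linarith [le_max_right r (p - c * E (x + s))]
              nlinarith
          _ = kp * (u + u / p * (c * E x)) := by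
              rw [hVE, ← hap]
              ring
      have h3 : 0 ≤ p - c * E x := hr.le.trans hle
      calc (p - c * E x) * V lo x ≤ (p - c * E x) * (kp * (u + u / p * (c * E x))) :=
            mul_le_mul_of_nonneg_left hVle h3
        _ = kp * (p * u) - kp * (u / p) * (c * E x) ^ 2 := by
            field_simp
            ring
        _ ≤ kp * (p * u) := by
            have : 0 ≤ kp * (u / p) * (c * E x) ^ 2 := by positivity
            linarith
    · intro P hPm h1 h2 x y hxy
      refine div_le_div_of_nonneg_left (by positivity) (hVpos' P hPm h1 h2 y) ?_
      exact integral_mono (hint P hPm h1 h2 y) (hint P hPm h1 h2 x) fun s =>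
        localSpeed_antitone hkp hk hv hv0 hv1 hPm (fun y => hsub (hmem P h1 h2 y)) (by linarith)
    · intro P Q hPm h1 h2 hQm h3 h4 hPQ x
      refine div_le_div_of_nonneg_left (by positivity) (hVpos' Q hQm h3 h4 x) ?_
      exact integral_mono (hint Q hQm h3 h4 x) (hint P hPm h1 h2 x) fun s =>
        localSpeed_le_localSpeed hkp hk hv (hsub (hmem P h1 h2 _)) (hsub (hmem Q h3 h4 _)) (hPQ _)
    · intro P hPm h1 h2 x
      have hpos := hVpos' P hPm h1 h2 x
      simp only
      rw [div_le_iff₀ hpos]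
      have hp_le : kp * (p * u) ≤ p * V P x := by
        nlinarith [mul_le_mul_of_nonneg_left (hVpos P hPm h1 h2 x) hp0.le]
      rcases le_total p (p - c * E x + K * c ^ 2 * E x ^ 2) with hle | hle
      · rwa [show hi x = p from min_eq_left hle]
      rw [show hi x = p - c * E x + K * c ^ 2 * E x ^ 2 from min_eq_right hle]
      have hKE : K * c * E x ≤ 1 := by
        have : (c * E x) * (K * c * E x) ≤ (c * E x) * 1 := by linarith
        exact le_of_mul_le_mul_left this (mul_pos hc0 (hE0 x))
      have hx : 0 ≤ x := by
        by_contra! hneg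
        have h1 : 1 < E x := Real.one_lt_exp_iff.2 (by nlinarith)
        nlinarith [mul_le_mul_of_nonneg_right hKc (hE0 x).le]
      have hVge : kp * (u + a * c * (u / (a * p)) * E x - (a * (K * c ^ 2) + M * c ^ 2) * b * E x ^ 2)
          ≤ V P x := by
        rw [← hVE]
        refine integral_mono_ae (hVE_int x _ _) (hint P hPm h1 h2 x) ?_
        filter_upwards [hμ] with s hs
        have hm := hmem P h1 h2 (x + s)
        have hmhi := hmem hi hlohi le_rfl (x + s)
        simp only [localSpeed]
        rw [kappa_of_nonneg (by linarith [hs.1])]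
        refine mul_le_mul_of_nonneg_left ?_ hkp.le
        refine le_trans ?_ (hv (hsub hm) (hsub hmhi) (h2 _))
        refine le_trans ?_ (htay _ hmhi)
        have hEle : E (x + s) ≤ E x := hEanti (by linarith [hs.1])
        have hKE' : K * c * E (x + s) ≤ 1 := (mul_le_mul_of_nonneg_left hEle (by positivity)).trans hKE
        have hq : p - hi (x + s) = c * E (x + s) - K * c ^ 2 * E (x + s) ^ 2 := by
          have : p - c * E (x + s) + K * c ^ 2 * E (x + s) ^ 2 ≤ p := by
            nlinarith [mul_le_mul_of_nonneg_left hKE' (mul_pos hc0 (hE0 (x + s))).le]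
          simp only [hhi]
          rw [min_eq_right this]
          ring
        have hq0 : 0 ≤ p - hi (x + s) := by linarith [hmhi.2]
        have hq1 : p - hi (x + s) ≤ c * E (x + s) := by
          have : 0 ≤ K * c ^ 2 * E (x + s) ^ 2 := by positivity
          linarith
        have hsq : M * (p - hi (x + s)) ^ 2 ≤ M * (c * E (x + s)) ^ 2 :=
          mul_le_mul_of_nonneg_left (pow_le_pow_left₀ hq0 hq1 2) hM
        have hq' : a * (p - hi (x + s)) = a * (c * E (x + s) - K * c ^ 2 * E (x + s) ^ 2) := by rw [hq]
        linarith
      set z := c * E x - K * c ^ 2 * E x ^ 2 with hz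
      have hz0 : 0 ≤ z := by linarith
      have hz1 : z ≤ c * E x := by
        have : 0 ≤ K * c ^ 2 * E x ^ 2 := by positivity
        linarith
      have hz2 : r ≤ p - z := by linarith [hquad (E x)]
      set R := (u / p - a * b) * K - M * b with hR
      have hR0 : 0 ≤ R := by
        have : 0 < r * R := (div_pos hu hp0).trans_le hK2
        exact (pos_of_mul_pos_right this hr.le).le
      have hVeq : kp * (u + a * c * (u / (a * p)) * E x - (a * (K * c ^ 2) + M * c ^ 2) * b * E x ^ 2)
          = kp * (u + u / p * z + R * (c * E x) ^ 2) := by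
        rw [hz, hR, ← hap]
        ring
      have hfin : 0 ≤ (p - z) * R * (c * E x) ^ 2 - u / p * z ^ 2 := by
        have h5 : z ^ 2 ≤ (c * E x) ^ 2 := pow_le_pow_left₀ hz0 hz1 2
        have h6 : u / p * z ^ 2 ≤ u / p * (c * E x) ^ 2 :=
          mul_le_mul_of_nonneg_left h5 (div_pos hu hp0).le
        have h7 : u / p ≤ (p - z) * R := hK2.trans (mul_le_mul_of_nonneg_right hz2 hR0)
        have h8 := mul_le_mul_of_nonneg_right h7 (sq_nonneg (c * E x))
        linarith
      calc kp * (p * u)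
          ≤ kp * (p * u) + kp * ((p - z) * R * (c * E x) ^ 2 - u / p * z ^ 2) := by
            have := mul_nonneg hkp.le hfin
            linarith
        _ = (p - z) * (kp * (u + u / p * z + R * (c * E x) ^ 2)) := by
            field_simp
            ring
        _ ≤ (p - z) * V P x := by
            rw [← hVeq]
            exact mul_le_mul_of_nonneg_left hVge (hr.le.trans hz2)
        _ = (p - c * E x + K * c ^ 2 * E x ^ 2) * V P x := by
            rw [hz]
            ring
  obtain ⟨P, hPm, hP1, hP2, hPT⟩ := hex
  have hm := hmem P hP1 hP2
  refine ⟨P, hPm, hm, fun x => ?_, fun x => (le_max_right _ _).trans (hP1 x),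
    fun x => (hP2 x).trans (min_le_right _ _)⟩
  have := congrFun hPT x
  rw [div_eq_iff (hVpos' P hPm hP1 hP2 x).ne'] at this
  exact this.symm

lemma le_kernelMeasure_real_Iio {h : ℝ} (hh : 0 < h) {w : ℝ → ℝ}
    [IsFiniteMeasure (kernelMeasure h w)]
    (hw_pos : ∀ x ∈ Ioo 0 h, 0 < w x) (hw_anti : AntitoneOn w (Ioo 0 h))
    {t : ℝ} (ht0 : 0 < t) (ht : t ≤ h / 2) :
    w (h / 2) * t ≤ (kernelMeasure h w).real (Iio t) := by
  have hmid : h / 2 ∈ Ioo 0 h := ⟨half_pos hh, half_lt_self hh⟩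
  have hsub : Ioo 0 t ⊆ Ioo 0 h := Ioo_subset_Ioo_right (by linarith)
  have h1 : ENNReal.ofReal (w (h / 2) * t) ≤ kernelMeasure h w (Ioo 0 t) := by
    rw [kernelMeasure, withDensity_apply _ measurableSet_Ioo,
      Measure.restrict_restrict measurableSet_Ioo, inter_eq_self_of_subset_left hsub]
    calc ENNReal.ofReal (w (h / 2) * t)
        = ∫⁻ _ in Ioo 0 t, ENNReal.ofReal (w (h / 2)) := by
          rw [setLIntegral_const, Real.volume_Ioo, sub_zero, ENNReal.ofReal_mul (hw_pos _ hmid).le]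
      _ ≤ ∫⁻ s in Ioo 0 t, ENNReal.ofReal (w s) :=
          setLIntegral_mono' measurableSet_Ioo fun s hs =>
            ENNReal.ofReal_le_ofReal (hw_anti (hsub hs) hmid (hs.2.le.trans ht))
  rw [measureReal_def, ← ENNReal.ofReal_le_iff_le_toReal (measure_ne_top _ _)]
  exact h1.trans (measure_mono Ioo_subset_Iio_self)

/-- The jump of the road coefficient forces a kink of any monotone stationary solution. -/
lemma not_differentiableAt_zero_of_stationary {h : ℝ} (hh : 0 < h) {w : ℝ → ℝ}
    (hw_cont : ContinuousOn w (Ioo 0 h)) (hw_pos : ∀ x ∈ Ioo 0 h, 0 < w x)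
    (hw_anti : AntitoneOn w (Ioo 0 h))
    (hw_int : ∫ s in (0 : ℝ)..h, w s = 1) {C : ℝ} (hC : ∀ x, w x ≤ C)
    {km kp : ℝ} (hkp : 0 < kp) (hk : kp < km) {v P : ℝ → ℝ} (hv : AntitoneOn v (Icc 0 1))
    (hv0 : v 0 = 1) (hv1 : v 1 = 0) {Cv : NNReal} (hvL : LipschitzOnWith Cv v (Icc 0 1))
    (hPm : Monotone P) (hP : ∀ y, P y ∈ Icc (0 : ℝ) 1) (hvP : 0 < v (P 0)) {F : ℝ} (hF : 0 < F)
    (heq : ∀ x, P x * ∫ s, localSpeed km kp v P (x + s) ∂kernelMeasure h w = F) :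
    ¬ DifferentiableAt ℝ P 0 := by
  intro hdiff
  have hprob := isProbabilityMeasure_kernelMeasure hh hw_cont hw_pos hw_int
  set μ := kernelMeasure h w with hμdef
  have hμ : ∀ᵐ s ∂μ, s ∈ Ioo 0 h := ae_mem_Ioo_kernelMeasure h w
  set V : ℝ → ℝ := fun x => ∫ s, localSpeed km kp v P (x + s) ∂μ with hV
  have hLip := lipschitzWith_average hh hw_cont hw_pos hw_int hC
    (localSpeed_antitone hkp hk.le hv hv0 hv1 hPm hP)
    fun x => localSpeed_mem_Icc hkp hk.le hv hv0 hv1 (hP x)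
  have hV0 : ∀ x, 0 ≤ V x := fun x => integral_nonneg fun s =>
    (localSpeed_mem_Icc hkp hk.le hv hv0 hv1 (hP _)).1
  have hVF : ∀ x, F ≤ V x := fun x => by
    rw [← heq x]
    exact mul_le_of_le_one_left (hV0 x) (hP x).2
  have hPpos : ∀ x, 0 < P x := fun x => (hP x).1.lt_of_ne fun h0 => by
    have := heq x
    rw [← h0, zero_mul] at this
    exact hF.ne this
  set CP : NNReal := Real.toNNReal F⁻¹ * (C * km).toNNReal
  have hPL : LipschitzWith CP P := by
    refine LipschitzWith.of_dist_le_mul fun x y => ?_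
    have h1 : (P x - P y) * V x = P y * (V y - V x) := by
      have h2 : P x * V x = F := heq x
      have h3 : P y * V y = F := heq y
      linear_combination h2 - h3
    have h4 : |P x - P y| * V x = P y * |V y - V x| := by
      rw [← abs_of_nonneg (hV0 x), ← abs_mul, abs_of_nonneg (hV0 x), h1, abs_mul,
        abs_of_nonneg (hP y).1]
    have h5 : |P x - P y| * F ≤ |V x - V y| := by
      calc |P x - P y| * F ≤ |P x - P y| * V x :=
            mul_le_mul_of_nonneg_left (hVF x) (abs_nonneg _)
        _ ≤ |V x - V y| := by
            rw [h4, abs_sub_comm]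
            exact mul_le_of_le_one_left (abs_nonneg _) (hP y).2
    have h6 := hLip.dist_le_mul x y
    rw [Real.dist_eq] at h6 ⊢
    simp only [CP, NNReal.coe_mul, Real.coe_toNNReal _ (inv_pos.2 hF).le]
    rw [mul_assoc, inv_mul_eq_div, le_div_iff₀ hF]
    exact h5.trans h6
  set u : ℝ → ℝ := fun y => v (P y) with hu
  have huL : LipschitzWith (Cv * CP) u := by
    rw [← lipschitzOnWith_univ]
    exact hvL.comp hPL.lipschitzOnWith fun y _ => hP y
  have huL' : LipschitzWith (Cv * CP) fun y => u (min y 0) := by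
    simpa [Function.comp_def] using huL.comp (LipschitzWith.id.min_const 0)
  set g : ℝ → ℝ := fun y => kp * u y + (km - kp) * (u (min y 0) - u 0) with hg
  set J : ℝ := (km - kp) * u 0 with hJ
  have hJ0 : 0 < J := mul_pos (sub_pos.2 hk) hvP
  obtain ⟨Cg, hgL⟩ : ∃ Cg, LipschitzWith Cg g := by
    refine ⟨Real.toNNReal km * (Cv * CP), LipschitzWith.of_dist_le_mul fun x y => ?_⟩
    have h1 := huL.dist_le_mul x y
    have h2 := huL'.dist_le_mul x y
    rw [Real.dist_eq] at h1 h2 ⊢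
    have h3 : g x - g y = kp * (u x - u y) + (km - kp) * (u (min x 0) - u (min y 0)) := by
      simp only [hg]; ring
    rw [NNReal.coe_mul, Real.coe_toNNReal _ (hkp.trans hk).le, h3]
    refine (abs_add_le _ _).trans ?_
    rw [abs_mul, abs_mul, abs_of_pos hkp, abs_of_pos (sub_pos.2 hk)]
    have h4 := mul_le_mul_of_nonneg_left h1 hkp.le
    have h5 := mul_le_mul_of_nonneg_left h2 (sub_pos.2 hk).le
    linarith
  have hdecomp : ∀ x s, g (x + s) = localSpeed km kp v P (x + s)
      - J * (Iio (-x)).indicator (fun _ => (1 : ℝ)) s := by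
    intro x s
    simp only [hg, localSpeed, hJ]
    rcases lt_or_ge (x + s) 0 with hneg | hpos
    · rw [kappa_of_neg hneg, min_eq_left hneg.le, indicator_of_mem (by simp; linarith)]
      ring
    · rw [kappa_of_nonneg hpos, min_eq_right hpos, indicator_of_notMem (by simp; linarith)]
      ring
  set U : ℝ → ℝ := fun x => ∫ s, g (x + s) ∂μ with hU
  have hf_int : ∀ x, Integrable (fun s => localSpeed km kp v P (x + s)) μ :=
    integrable_localSpeed hkp hk.le hv hv0 hv1 hPm hP
  have hi_int : ∀ x, Integrable (fun s => J * (Iio (-x)).indicator (fun _ => (1 : ℝ)) s) μ :=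
    fun x => ((integrable_const _).indicator measurableSet_Iio).const_mul _
  have hUV : ∀ x, μ.real (Iio (-x)) = (V x - U x) / J := by
    intro x
    rw [eq_div_iff hJ0.ne']
    simp only [hU, hdecomp]
    rw [integral_sub (hf_int x) (hi_int x), integral_const_mul,
      integral_indicator_const _ measurableSet_Iio]
    simp only [hV, smul_eq_mul]
    ring
  have hUd : DifferentiableAt ℝ U 0 := by
    refine (hasDerivAt_integral_of_dominated_loc_of_lip (F := fun x s => g (x + s))
      (F' := deriv g) (s := univ) (bound := fun _ => (Cg : ℝ)) univ_mem ?_ ?_ ?_ ?_ ?_ ?_).2.differentiableAt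
    · exact Eventually.of_forall fun x =>
        (hgL.continuous.comp (continuous_const.add continuous_id)).aestronglyMeasurable
    · simp only [hdecomp]
      exact (hf_int 0).sub (hi_int 0)
    · exact (measurable_deriv g).aestronglyMeasurable
    · refine ae_of_all _ fun s => ?_
      rw [lipschitzOnWith_univ]
      simpa [Function.comp_def] using hgL.comp (LipschitzWith.id.add (LipschitzWith.const s))
    · exact integrable_const _
    · have hae : ∀ᵐ s ∂μ, DifferentiableAt ℝ g s :=
        (kernelMeasure_absolutelyContinuous h w).ae_le hgL.ae_differentiableAt_real
      filter_upwards [hae] with s hs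
      have : HasDerivAt g (deriv g s) (0 + s) := by simpa using hs.hasDerivAt
      exact this.comp_add_const 0 s
  have hVd : DifferentiableAt ℝ V 0 := by
    have : V = fun x => F / P x := funext fun x => by
      rw [eq_div_iff (hPpos x).ne', mul_comm]
      exact heq x
    rw [this]
    exact (differentiableAt_const _).div hdiff (hPpos 0).ne'
  have hKd : DifferentiableAt ℝ (fun x => μ.real (Iio (-x))) 0 := by
    rw [funext hUV]
    exact (hVd.sub hUd).div_const _
  have hK0 : μ.real (Iio (-0)) = 0 := by
    rw [measureReal_eq_zero_iff, neg_zero]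
    refine measure_mono_null (fun s hs => ?_) hμ
    simp only [mem_Iio] at hs
    simp [hs.not_gt]
  have hmin : IsLocalMin (fun x => μ.real (Iio (-x))) 0 :=
    Eventually.of_forall fun x => by
      simp only [hK0]
      exact measureReal_nonneg
  have hder := hKd.hasDerivAt
  rw [hmin.deriv_eq_zero, hasDerivAt_iff_isLittleO] at hder
  have hmid : h / 2 ∈ Ioo 0 h := ⟨half_pos hh, half_lt_self hh⟩
  have hwm := hw_pos _ hmid
  have hev := hder.def (half_pos hwm)
  rw [Metric.eventually_nhds_iff] at hev
  obtain ⟨ε, hε, hev⟩ := hev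
  set t := min (ε / 2) (h / 2) with ht
  have ht0 : 0 < t := lt_min (by linarith) (by linarith)
  have htε : t < ε := (min_le_left _ _).trans_lt (by linarith)
  have h1 := hev (y := -t) (by simpa [abs_of_pos ht0] using htε)
  have h2 := le_kernelMeasure_real_Iio hh hw_pos hw_anti ht0 (min_le_right _ _)
  simp only [hK0] at h1
  simp only [neg_neg, sub_zero, smul_zero, norm_neg, Real.norm_of_nonneg ht0.le,
    Real.norm_of_nonneg (measureReal_nonneg (μ := μ) (s := Iio t))] at h1
  nlinarith

lemma eq_of_concaveOn_of_eq {g : ℝ → ℝ} {s : Set ℝ} (hg : ConcaveOn ℝ s g) {r p L : ℝ}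
    (hr : r ∈ s) (hp : p ∈ s) (hL : L ∈ Icc r p) (hlt : g r < g p) (heq : g L = g r) : L = r := by
  by_contra hne
  have hrL : r < L := lt_of_le_of_ne hL.1 (Ne.symm hne)
  rcases hL.2.eq_or_lt with rfl | hLp
  · exact hlt.ne' heq
  have hslope := hg.slope_anti_adjacent hr hp hrL hLp
  rw [heq, sub_self, zero_div] at hslope
  have := div_pos (sub_pos.2 hlt) (sub_pos.2 hLp)
  linarith

lemma tendsto_atBot_of_stationary {μ : Measure ℝ} [IsProbabilityMeasure μ] {h : ℝ}
    (hμ : ∀ᵐ s ∂μ, s ∈ Ioo 0 h) {km kp : ℝ} (hkp : 0 < kp) (hk : kp ≤ km) {v P : ℝ → ℝ}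
    (hv : AntitoneOn v (Icc 0 1)) (hv0 : v 0 = 1) (hv1 : v 1 = 0)
    (hvc : ContinuousOn v (Icc 0 1))
    (hg : ConcaveOn ℝ (Icc 0 1) fun y => y * v y) {r p F : ℝ} (hr : 0 < r) (hrp : r < p)
    (hp : p < 1) (hF : F = km * (r * v r)) (hlt : r * v r < p * v p) (hPm : Monotone P)
    (hP : ∀ x, P x ∈ Icc r p)
    (heq : ∀ x, P x * ∫ s, localSpeed km kp v P (x + s) ∂μ = F) :
    Tendsto P atBot (𝓝 r) := by
  have hsub : Icc r p ⊆ Icc 0 1 := Icc_subset_Icc hr.le hp.le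
  have hP01 := fun x => hsub (hP x)
  have hbdd : BddBelow (range P) := ⟨r, by rintro _ ⟨x, rfl⟩; exact (hP x).1⟩
  have hlim := tendsto_atBot_ciInf hPm hbdd
  set L := ⨅ x, P x
  have hL : L ∈ Icc r p := isClosed_Icc.mem_of_tendsto hlim (Eventually.of_forall hP)
  have hvL : ContinuousAt v L := hvc.continuousAt
    (Icc_mem_nhds (hr.trans_le hL.1) (hL.2.trans_lt hp))
  have hvP : Tendsto (fun x => v (P x)) atBot (𝓝 (v L)) := hvL.tendsto.comp hlim
  have hvP' : Tendsto (fun x => v (P (x + h))) atBot (𝓝 (v L)) :=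
    hvP.comp (tendsto_atBot_add_const_right _ _ tendsto_id)
  have hkm := hkp.le.trans hk
  have hint := integrable_localSpeed (μ := μ) hkp hk hv hv0 hv1 hPm hP01
  have hup : F ≤ L * (km * v L) := by
    refine ge_of_tendsto (hlim.mul (hvP.const_mul km)) ?_
    filter_upwards with x
    rw [← heq x]
    refine mul_le_mul_of_nonneg_left ?_ (hP01 x).1
    have : ∫ s, localSpeed km kp v P (x + s) ∂μ ≤ ∫ _, km * v (P x) ∂μ := by
      refine integral_mono_ae (hint x) (integrable_const _) ?_
      filter_upwards [hμ] with s hs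
      exact mul_le_mul (kappa_mem_Icc hk _).2 (hv (hP01 _) (hP01 _) (hPm (by linarith [hs.1])))
        (mem_Icc_of_antitoneOn hv hv0 hv1 (hP01 _)).1 hkm
    simpa using this
  have hlow : L * (km * v L) ≤ F := by
    refine le_of_tendsto (hlim.mul (hvP'.const_mul km)) ?_
    filter_upwards [eventually_lt_atBot (-h)] with x hx
    rw [← heq x]
    refine mul_le_mul_of_nonneg_left ?_ (hP01 x).1
    have : ∫ _, km * v (P (x + h)) ∂μ ≤ ∫ s, localSpeed km kp v P (x + s) ∂μ := by
      refine integral_mono_ae (integrable_const _) (hint x) ?_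
      filter_upwards [hμ] with s hs
      simp only [localSpeed]
      rw [kappa_of_neg (by linarith [hs.2])]
      exact mul_le_mul_of_nonneg_left (hv (hP01 _) (hP01 _) (hPm (by linarith [hs.2]))) hkm
    simpa using this
  have hLr : L = r := by
    refine eq_of_concaveOn_of_eq hg (hsub ⟨le_rfl, hrp.le⟩) (hsub ⟨hrp.le, le_rfl⟩) hL hlt ?_
    have h1 : km * (L * v L) = km * (r * v r) := by linarith
    exact mul_left_cancel₀ (hkp.trans_le hk).ne' h1
  rwa [hLr] at hlim

/-- Second-order lower bound to the left of `p`. -/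
lemma exists_quadratic_lower_bound {v : ℝ → ℝ} (hv : ContDiffOn ℝ 2 v (Icc 0 1)) {p v' : ℝ}
    (hp0 : 0 < p) (hp1 : p ≤ 1) (hd : HasDerivAt v v' p) :
    ∃ M, 0 ≤ M ∧ ∀ y ∈ Icc 0 p, v p - v' * (p - y) - M * (p - y) ^ 2 ≤ v y := by
  have hf : ContDiffOn ℝ ((1 : ℕ) + 1) (fun y => v (p - y)) (Icc 0 p) := by
    have h2 : ((1 : ℕ) + 1 : WithTop ℕ∞) = 2 := by norm_num
    rw [h2]
    exact hv.comp (contDiff_const.sub contDiff_id).contDiffOn fun y hy =>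
      ⟨by linarith [hy.2], by linarith [hy.1]⟩
  obtain ⟨C, hC⟩ := exists_taylor_mean_remainder_bound hp0.le hf
  have hd0 : HasDerivAt (fun y => v (p - y)) (-v') 0 := by
    have : HasDerivAt v v' (p - 0) := by simpa using hd
    exact this.comp_const_sub p 0
  have hdw : derivWithin (fun y => v (p - y)) (Icc 0 p) 0 = -v' :=
    hd0.hasDerivWithinAt.derivWithin (uniqueDiffOn_Icc hp0 0 ⟨le_rfl, hp0.le⟩)
  refine ⟨max C 0, le_max_right _ _, fun y hy => ?_⟩
  have h1 := hC (p - y) ⟨by linarith [hy.2], by linarith [hy.1]⟩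
  rw [show (1 : ℕ) = 0 + 1 from rfl, taylorWithinEval_succ, taylor_within_zero_eval,
    iteratedDerivWithin_one, hdw] at h1
  simp only [Real.norm_eq_abs, sub_sub_cancel, sub_zero, smul_eq_mul] at h1
  norm_num at h1
  have h2 := (abs_le.1 h1).1
  have h3 : C * (p - y) ^ 2 ≤ max C 0 * (p - y) ^ 2 :=
    mul_le_mul_of_nonneg_right (le_max_left _ _) (sq_nonneg _)
  linarith

/-- **Theorem 3.2, Case C1.** For `κ⁻ > κ⁺ > 0` and `ρ⁻ < ρ̂ < ρ⁺` with
`f̄ = κ⁻ρ⁻v(ρ⁻) = κ⁺ρ⁺v(ρ⁺) > 0`, there exist infinitely many continuous monotone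
stationary profiles for (M2); moreover every such profile fails to be differentiable
at `x = 0`. -/
theorem stmt_14 (h : ℝ) (hh : 0 < h) (w : ℝ → ℝ)
    (hw_supp : ∀ x, x ∉ Ico 0 h → w x = 0)
    (hw_cont : ContinuousOn w (Ico 0 h))
    (hw_bdd : ∃ Mw, ∀ x, w x ≤ Mw)
    (hw_pos : ∀ x ∈ Ioo 0 h, 0 < w x)
    (hw_anti : StrictAntiOn w (Ioo 0 h))
    (hw_int1 : (∫ s in (0:ℝ)..h, w s) = 1)
    (v : ℝ → ℝ) (hv : ContDiffOn ℝ 2 v (Icc 0 1))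
    (hv0 : v 0 = 1) (hv1 : v 1 = 0)
    (hv'neg : ∀ ρ ∈ Icc (0:ℝ) 1, deriv v ρ < 0)
    (hv''np : ∀ ρ ∈ Icc (0:ℝ) 1, deriv (deriv v) ρ ≤ 0)
    (rhohat : ℝ) (hrhohat_mem : rhohat ∈ Ioo (0:ℝ) 1)
    (hrhohat_crit : deriv (fun ρ => ρ * v ρ) rhohat = 0)
    (hrhohat_uniq : ∀ ρ ∈ Ioo (0:ℝ) 1, deriv (fun ρ => ρ * v ρ) ρ = 0 → ρ = rhohat)
    (km kp : ℝ) (hk : 0 < kp ∧ kp < km)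
    (rhom rhop fbar : ℝ)
    (hrhom : rhom ∈ Ioo (0:ℝ) 1) (hrhop : rhop ∈ Ioo (0:ℝ) 1)
    (hord : rhom < rhohat ∧ rhohat < rhop)
    (hfm : fbar = km * (rhom * v rhom)) (hfp : fbar = kp * (rhop * v rhop))
    (hfpos : 0 < fbar) :
    {P : ℝ → ℝ | IsProfileM2 h w v km kp fbar rhom rhop P ∧ Monotone P}.Infinite ∧
    (∀ P : ℝ → ℝ, IsProfileM2 h w v km kp fbar rhom rhop P ∧ Monotone P →
      ¬ DifferentiableAt ℝ P 0) := by
  obtain ⟨C, hC⟩ := hw_bdd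
  obtain ⟨hkp, hk⟩ := hk
  obtain ⟨hr0, hr1⟩ := hrhom
  obtain ⟨hp0, hp1⟩ := hrhop
  have hrp : rhom < rhop := hord.1.trans hord.2
  have hcont : ContinuousOn w (Ioo 0 h) := hw_cont.mono Ioo_subset_Ico_self
  have hprob := isProbabilityMeasure_kernelMeasure hh hcont hw_pos hw_int1
  have hμ := ae_mem_Ioo_kernelMeasure h w
  have hvd : ∀ y ∈ Icc (0 : ℝ) 1, DifferentiableAt ℝ v y := fun y hy =>
    differentiableAt_of_deriv_ne_zero (hv'neg y hy).ne
  have hvc : ContinuousOn v (Icc 0 1) := hv.continuousOn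
  have hva : StrictAntiOn v (Icc 0 1) :=
    strictAntiOn_of_deriv_neg (convex_Icc 0 1) hvc fun y hy => hv'neg y (interior_subset hy)
  have hvcv : ConcaveOn ℝ (Icc 0 1) v := by
    refine concaveOn_of_deriv2_nonpos (convex_Icc 0 1) hvc
      (fun y hy => (hvd y (interior_subset hy)).differentiableWithinAt) ?_
      fun y hy => hv''np y (interior_subset hy)
    refine (ContDiffOn.deriv_of_isOpen (n := 2) (m := 1) (hv.mono interior_subset) isOpen_interior
      (by norm_num)).differentiableOn (by norm_num)
  have hgcv : ConcaveOn ℝ (Icc 0 1) fun y => y * v y :=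
    (concaveOn_id (convex_Icc 0 1)).mul hvcv (fun y hy => hy.1)
      (fun y hy => (mem_Icc_of_antitoneOn hva.antitoneOn hv0 hv1 hy).1)
      (monotoneOn_id.antivaryOn hva.antitoneOn)
  have hpI : rhop ∈ Icc (0 : ℝ) 1 := ⟨hp0.le, hp1.le⟩
  have hsub : Icc rhom rhop ⊆ Icc 0 1 := Icc_subset_Icc hr0.le hp1.le
  have hvpos : ∀ y ∈ Ico (0 : ℝ) 1, 0 < v y := fun y hy =>
    hv1 ▸ hva ⟨hy.1, hy.2.le⟩ ⟨zero_le_one, le_rfl⟩ hy.2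
  have hu := hvpos rhop ⟨hp0.le, hp1⟩
  have hdp := hvd rhop hpI
  set a := -deriv v rhop with ha_def
  have ha : 0 < a := neg_pos.2 (hv'neg _ hpI)
  have hgd : ∀ y ∈ Icc (0 : ℝ) 1, DifferentiableAt ℝ (fun z => z * v z) y := fun y hy =>
    differentiableAt_id.mul (hvd y hy)
  have hpa : v rhop < a * rhop := by
    have h1 : deriv (fun y => y * v y) rhop = v rhop - a * rhop := by
      have := ((hasDerivAt_id rhop).mul hdp.hasDerivAt).deriv
      simp only [id, Pi.mul_def] at this
      rw [this, ha_def]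
      ring
    have h2 := hgcv.antitoneOn_deriv hgd ⟨hrhohat_mem.1.le, hrhohat_mem.2.le⟩ hpI hord.2.le
    rw [hrhohat_crit, h1] at h2
    have h3 : v rhop - a * rhop ≠ 0 := fun h0 =>
      hord.2.ne' (hrhohat_uniq rhop ⟨hp0, hp1⟩ (h1.trans h0))
    have h4 := lt_of_le_of_ne h2 h3
    linarith
  obtain ⟨l, hl, hly⟩ := exists_laplace_eq hμ (y := v rhop / (a * rhop)) (by positivity)
    ((div_lt_one (by positivity)).2 hpa)
  have hlt := laplace_two_mul_lt hμ hl
  rw [hly, lt_div_iff₀ (by positivity)] at hlt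
  set b := ∫ s, Real.exp (-(2 * l) * s) ∂kernelMeasure h w with hb
  obtain ⟨M, hM, htay⟩ := exists_quadratic_lower_bound hv hp0 hp1.le hdp.hasDerivAt
  have hδ : 0 < v rhop / rhop - a * b := by
    rw [sub_pos, lt_div_iff₀ hp0]
    linarith
  obtain ⟨K, hK0, hK1, hK2⟩ : ∃ K, 0 < K ∧ 1 ≤ K * (rhop - rhom) ∧
      v rhop / rhop ≤ rhom * ((v rhop / rhop - a * b) * K - M * b) := by
    have h1 : Tendsto (fun K => K * (rhop - rhom)) atTop atTop :=
      tendsto_id.atTop_mul_const (sub_pos.2 hrp)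
    have h2 : Tendsto (fun K => rhom * ((v rhop / rhop - a * b) * K - M * b)) atTop atTop :=
      (tendsto_atTop_add_const_right _ _ (tendsto_id.const_mul_atTop hδ)).const_mul_atTop hr0
    exact ((eventually_gt_atTop 0).and ((h1.eventually_ge_atTop 1).and
      (h2.eventually_ge_atTop _))).exists
  have havg : ∀ P x, avgVel h w v km kp P x
      = ∫ s, localSpeed km kp v P (x + s) ∂kernelMeasure h w := fun P x =>
    (integral_kernelMeasure hh hcont hw_pos _).symm
  refine ⟨?_, ?_⟩
  · have hex : ∀ c, rhop - rhom ≤ c → ∃ P : ℝ → ℝ,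
        (IsProfileM2 h w v km kp fbar rhom rhop P ∧ Monotone P) ∧
        (∀ x, rhop - c * Real.exp (-l * x) ≤ P x) ∧
        ∀ x, P x ≤ rhop - c * Real.exp (-l * x) + K * c ^ 2 * Real.exp (-l * x) ^ 2 := by
      intro c hc
      obtain ⟨P, hPm, hP, heq, hlow, hup⟩ := exists_monotone_solution hμ hkp hk.le hva.antitoneOn
        hv0 hv1 hr0 hrp hp1 hu rfl ha hM (hfm.symm.trans hfp)
        (fun y hy => by
          rcases hy.2.eq_or_lt with rfl | hlt
          · simp
          have h1 := hvcv.le_slope_of_hasDerivAt (hsub hy) hpI hlt hdp.hasDerivAt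
          rw [slope_def_field, le_div_iff₀ (sub_pos.2 hlt)] at h1
          rw [ha_def]
          linarith)
        (fun y hy => by
          have h1 := htay y ⟨hr0.le.trans hy.1, hy.2⟩
          rw [ha_def]
          linarith) hl (by rw [hly]; field_simp) hb.symm hK0 hK1 hK2 hc
      rw [← hfp] at heq
      refine ⟨P, ⟨⟨?_, fun x => hsub (hP x), fun x => by rw [havg]; exact heq x, ?_, ?_⟩, hPm⟩,
        hlow, hup⟩
      · have hLip := lipschitzWith_average hh hcont hw_pos hw_int1 hC
          (localSpeed_antitone hkp hk.le hva.antitoneOn hv0 hv1 hPm fun x => hsub (hP x))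
          fun x => localSpeed_mem_Icc hkp hk.le hva.antitoneOn hv0 hv1 (hsub (hP x))
        have hne : ∀ x, ∫ s, localSpeed km kp v P (x + s) ∂kernelMeasure h w ≠ 0 := fun x h0 => by
          have := heq x
          rw [h0, mul_zero] at this
          exact hfpos.ne this
        have : P = fun x => fbar / ∫ s, localSpeed km kp v P (x + s) ∂kernelMeasure h w :=
          funext fun x => by rw [eq_div_iff (hne x)]; exact heq x
        rw [this]
        exact continuous_const.div hLip.continuous hne
      · refine tendsto_atBot_of_stationary hμ hkp hk.le hva.antitoneOn hv0 hv1 hvc hgcv hr0 hrp hp1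
          hfm ?_ hPm hP heq
        have hpos : 0 < rhom * v rhom := mul_pos hr0 (hvpos _ ⟨hr0.le, hr1⟩)
        have h1 : km * (rhom * v rhom) = kp * (rhop * v rhop) := hfm.symm.trans hfp
        refine lt_of_mul_lt_mul_left (a := kp) ?_ hkp.le
        rw [← h1]
        exact mul_lt_mul_of_pos_right hk hpos
      · refine tendsto_of_tendsto_of_tendsto_of_le_of_le ?_ tendsto_const_nhds hlow fun x => (hP x).2
        have h1 : Tendsto (fun x => Real.exp (-l * x)) atTop (𝓝 0) :=
          Real.tendsto_exp_atBot.comp (tendsto_id.const_mul_atTop_of_neg (neg_lt_zero.2 hl))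
        simpa using (h1.const_mul c).const_sub rhop
    choose! Φ hΦ hΦlow hΦup using hex
    refine infinite_of_injOn_mapsTo (s := Ici (rhop - rhom)) (f := Φ) ?_ (fun c hc => hΦ c hc)
      (Ici_infinite _)
    have hle : ∀ c ∈ Ici (rhop - rhom), ∀ d ∈ Ici (rhop - rhom), Φ c = Φ d → c ≤ d := by
      intro c hc d hd hcd
      have h1 : Tendsto (fun x => Real.exp (-l * x)) atTop (𝓝 0) :=
        Real.tendsto_exp_atBot.comp (tendsto_id.const_mul_atTop_of_neg (neg_lt_zero.2 hl))
      have h2 : Tendsto (fun x => c - K * c ^ 2 * Real.exp (-l * x)) atTop (𝓝 c) := by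
        simpa using (h1.const_mul (K * c ^ 2)).const_sub c
      refine le_of_tendsto h2 (Eventually.of_forall fun x => ?_)
      have h3 := hΦup c hc x
      have h4 := hΦlow d hd x
      rw [hcd] at h3
      refine le_of_mul_le_mul_right ?_ (Real.exp_pos (-l * x))
      linarith
    exact fun c hc d hd hcd => (hle c hc d hd hcd).antisymm (hle d hd c hc hcd.symm)
  · rintro P ⟨⟨-, hP, heq, -, htop⟩, hPm⟩
    obtain ⟨Cv, hvL⟩ := hv.exists_lipschitzOnWith two_ne_zero (convex_Icc 0 1) isCompact_Icc
    refine not_differentiableAt_zero_of_stationary hh hcont hw_pos hw_anti.antitoneOn hw_int1 hC hkp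
      hk hva.antitoneOn hv0 hv1 hvL hPm hP (hvpos _ ⟨(hP 0).1, ?_⟩) hfpos
      fun x => by rw [← havg]; exact heq x
    exact (hPm.ge_of_tendsto htop 0).trans_lt hp1
end

section
/- (Jump of the derivative of the averaged velocity at the road discontinuity.) Let h > 0, let w : [0,h] → ℝ be continuous with w(h) = 0, extended by 0 outside [0,h], and let κ(x) = κ⁻ for x < 0 and κ(x) = κ⁺ for x > 0. Let g : ℝ → ℝ be continuous and bounded, differentiable on (−∞,0) and on (0,∞) with bounded derivative. Define V(x) = ∫₀^h κ(x+s)·g(x+s)·w(s) ds. Then V has one-sided derivatives at x = 0 and V'(0+) − V'(0−) = (κ⁻ − κ⁺)·g(0)·w(0). (Applied with g = v∘P for a stationary (M2)-profile P, this yields the connecting condition P'(0+) − P'(0−) = (κ⁺ − κ⁻)·(P(0)/V(0))·v(P(0))·w(0).) -/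
open Set Filter Topology MeasureTheory

open scoped NNReal

/-- A continuous function on `ℝ`, differentiable off `0` with derivative bounded by `C` there,
is `C`-Lipschitz. -/
lemma lipschitzWith_of_nnnorm_deriv_le_of_ne_zero {g : ℝ → ℝ} {C : ℝ≥0} (hgc : Continuous g)
    (hneg : DifferentiableOn ℝ g (Iio 0)) (hpos : DifferentiableOn ℝ g (Ioi 0))
    (hb : ∀ x ≠ (0 : ℝ), ‖deriv g x‖₊ ≤ C) : LipschitzWith C g := by
  have hN : LipschitzOnWith C g (Iic 0) := by
    rw [← closure_Iio]
    exact ((convex_Iio (0 : ℝ)).lipschitzOnWith_of_nnnorm_deriv_le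
      (fun x hx => (hneg x hx).differentiableAt (Iio_mem_nhds hx))
      (fun x hx => hb x (ne_of_lt hx))).closure hgc.continuousOn
  have hP : LipschitzOnWith C g (Ici 0) := by
    rw [← closure_Ioi]
    exact ((convex_Ioi (0 : ℝ)).lipschitzOnWith_of_nnnorm_deriv_le
      (fun x hx => (hpos x hx).differentiableAt (Ioi_mem_nhds hx))
      (fun x hx => hb x (ne_of_gt hx))).closure hgc.continuousOn
  have key : ∀ a b : ℝ, a ≤ 0 → 0 ≤ b → dist (g a) (g b) ≤ C * dist a b := by
    intro a b ha hb
    have h1 := hN.dist_le_mul a ha 0 self_mem_Iic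
    have h2 := hP.dist_le_mul 0 self_mem_Ici b hb
    have h3 : dist a b = dist a 0 + dist 0 b := by
      rw [Real.dist_eq, Real.dist_eq, Real.dist_eq, abs_of_nonpos (by linarith : a - b ≤ 0),
        abs_of_nonpos (by linarith : a - 0 ≤ 0), abs_of_nonpos (by linarith : 0 - b ≤ 0)]
      ring
    rw [h3, mul_add]
    linarith [dist_triangle (g a) (g 0) (g b)]
  refine LipschitzWith.of_dist_le_mul fun a b => ?_
  rcases le_total a 0 with ha | ha <;> rcases le_total b 0 with hb | hb
  · exact hN.dist_le_mul a ha b hb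
  · exact key a b ha hb
  · rw [dist_comm, dist_comm a]
    exact key b a hb ha
  · exact hP.dist_le_mul a ha b hb

/-- Differentiation of `x ↦ ∫₀ʰ g (x + s) u s ds` at `0` for `g` Lipschitz and differentiable on
the positive half-line. -/
lemma hasDerivAt_integral_comp_add_mul {h : ℝ} (hh : 0 < h) {g u : ℝ → ℝ} {C : ℝ≥0}
    (hg : LipschitzWith C g) (hpos : DifferentiableOn ℝ g (Ioi 0)) (hu : Continuous u) :
    HasDerivAt (fun x => ∫ s in (0 : ℝ)..h, g (x + s) * u s)
      (∫ s in (0 : ℝ)..h, deriv g s * u s) 0 := by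
  have hgc : Continuous g := hg.continuous
  refine (intervalIntegral.hasDerivAt_integral_of_dominated_loc_of_lip
    (bound := fun s => (C : ℝ) * |u s|) (s := univ) univ_mem
    (Eventually.of_forall fun x => ?_) ?_ ?_ ?_ ?_ ?_).2
  · exact Continuous.aestronglyMeasurable (by fun_prop)
  · exact Continuous.intervalIntegrable (by fun_prop) _ _
  · exact ((measurable_deriv g).mul hu.measurable).aestronglyMeasurable
  · refine Eventually.of_forall fun s _ => LipschitzOnWith.of_dist_le_mul fun x _ y _ => ?_
    have h1 := hg.dist_le_mul (x + s) (y + s)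
    rw [dist_add_right] at h1
    rw [Real.coe_nnabs, abs_of_nonneg (by positivity), Real.dist_eq, ← sub_mul, abs_mul,
      ← Real.dist_eq]
    calc dist (g (x + s)) (g (y + s)) * |u s| ≤ C * dist x y * |u s| := by gcongr
      _ = C * |u s| * dist x y := by ring
  · exact Continuous.intervalIntegrable (by fun_prop) _ _
  · refine Eventually.of_forall fun s hs => ?_
    rw [uIoc_of_le hh.le] at hs
    have hd : HasDerivAt g (deriv g s) (0 + s) := by
      rw [zero_add]
      exact ((hpos s hs.1).differentiableAt (Ioi_mem_nhds hs.1)).hasDerivAt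
    exact (hd.comp_add_const 0 s).mul_const (u s)

/-- Derivative at `0` of an integral of a jointly continuous function over `[0, -x]`. -/
lemma hasDerivAt_integral_zero_neg {φ : ℝ → ℝ → ℝ} (hφ : Continuous φ.uncurry) :
    HasDerivAt (fun x => ∫ s in (0 : ℝ)..(-x), φ x s) (-φ 0 0) 0 := by
  rw [hasDerivAt_iff_isLittleO, Asymptotics.isLittleO_iff]
  intro ε hε
  obtain ⟨δ, hδ, H⟩ := Metric.continuousAt_iff.1 (hφ.continuousAt (x := ((0 : ℝ), (0 : ℝ)))) ε hε
  filter_upwards [Metric.ball_mem_nhds (0 : ℝ) hδ] with x hx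
  have hx' : |x| < δ := by simpa using hx
  have hint : IntervalIntegrable (φ x) volume 0 (-x) :=
    (hφ.comp (Continuous.prodMk_right x)).intervalIntegrable _ _
  have e : (∫ s in (0 : ℝ)..(-x), φ x s) - (∫ s in (0 : ℝ)..(-0), φ 0 s) - (x - 0) • (-φ 0 0)
      = ∫ s in (0 : ℝ)..(-x), (φ x s - φ 0 0) := by
    rw [intervalIntegral.integral_sub hint (by simp)]
    simp
  rw [e]
  refine (intervalIntegral.norm_integral_le_of_norm_le_const (C := ε) fun s hs => ?_).trans ?_
  · have hs' : |s| ≤ |x| := by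
      simpa using abs_sub_left_of_mem_uIcc (uIoc_subset_uIcc hs)
    have := H (x := (x, s)) (by
      rw [Prod.dist_eq]
      exact max_lt (by simpa using hx') (by simpa using hs'.trans_lt hx'))
    exact this.le
  · simp

/-- **jump of the derivative of the averaged velocity at the road
discontinuity.** With `w` continuous on `[0,h]`, `w(h) = 0`, `w ≡ 0` outside `[0,h]`,
`κ(x) = κ⁻` for `x < 0` and `κ⁺` for `x > 0`, and `g` continuous, bounded, differentiable
off `0` with bounded derivative, the function `V(x) = ∫₀ʰ κ(x+s)·g(x+s)·w(s) ds` has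
one-sided derivatives at `0` and `V'(0+) − V'(0−) = (κ⁻ − κ⁺)·g(0)·w(0)`. -/
theorem stmt_15 (h : ℝ) (hh : 0 < h) (w : ℝ → ℝ)
    (hw_cont : ContinuousOn w (Icc 0 h)) (hwh : w h = 0)
    (hw_supp : ∀ x, x ∉ Icc 0 h → w x = 0)
    (km kp : ℝ)
    (g : ℝ → ℝ) (hgc : Continuous g)
    (Mg : ℝ) (hgb : ∀ x, |g x| ≤ Mg)
    (hgd_neg : DifferentiableOn ℝ g (Iio 0))
    (hgd_pos : DifferentiableOn ℝ g (Ioi 0))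
    (Mg' : ℝ) (hg'b : ∀ x ≠ (0:ℝ), |deriv g x| ≤ Mg') :
    ∃ dm dp : ℝ,
      HasDerivWithinAt
        (fun x => ∫ s in (0:ℝ)..h, (if x + s < 0 then km else kp) * g (x + s) * w s)
        dm (Iic 0) 0 ∧
      HasDerivWithinAt
        (fun x => ∫ s in (0:ℝ)..h, (if x + s < 0 then km else kp) * g (x + s) * w s)
        dp (Ici 0) 0 ∧
      dp - dm = (km - kp) * g 0 * w 0 := by
  set u : ℝ → ℝ := IccExtend hh.le ((Icc 0 h).domRestrict w) with hu_def
  have hu : Continuous u := (continuousOn_iff_continuous_domRestrict.1 hw_cont).Icc_extend'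
  have huw : ∀ s ∈ Icc 0 h, u s = w s := fun s hs => by
    rw [hu_def, IccExtend_of_mem _ _ hs]
    rfl
  have hg : LipschitzWith Mg'.toNNReal g :=
    lipschitzWith_of_nnnorm_deriv_le_of_ne_zero hgc hgd_neg hgd_pos fun x hx =>
      NNReal.le_toNNReal_of_coe_le (hg'b x hx)
  have hF := hasDerivAt_integral_comp_add_mul hh hg hgd_pos hu
  have hG := hasDerivAt_integral_zero_neg (φ := fun x s => g (x + s) * u s)
    (by unfold Function.uncurry; fun_prop)
  have hint : ∀ x a b, IntervalIntegrable (fun s => g (x + s) * u s) volume a b := fun x a b =>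
    Continuous.intervalIntegrable (by fun_prop) _ _
  have hVpos : ∀ x ∈ Ici (0 : ℝ),
      (∫ s in (0 : ℝ)..h, (if x + s < 0 then km else kp) * g (x + s) * w s) =
        kp * ∫ s in (0 : ℝ)..h, g (x + s) * u s := by
    intro x hx
    rw [← intervalIntegral.integral_const_mul]
    refine intervalIntegral.integral_congr fun s hs => ?_
    rw [uIcc_of_le hh.le] at hs
    have : ¬ x + s < 0 := not_lt.2 (add_nonneg hx hs.1)
    simp only [if_neg this, huw s hs, mul_assoc]
  have hVneg : ∀ x ∈ Icc (-h) 0,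
      (∫ s in (0 : ℝ)..h, (if x + s < 0 then km else kp) * g (x + s) * w s) =
        kp * (∫ s in (0 : ℝ)..h, g (x + s) * u s) +
          (km - kp) * ∫ s in (0 : ℝ)..(-x), g (x + s) * u s := by
    intro x hx
    have hx0 : 0 ≤ -x := neg_nonneg.2 hx.2
    have hxh : -x ≤ h := neg_le.1 hx.1
    have e1 : EqOn (fun s => km * (g (x + s) * u s))
        (fun s => (if x + s < 0 then km else kp) * g (x + s) * w s) (uIoo 0 (-x)) := by
      intro s hs
      rw [uIoo_of_le hx0] at hs
      have : x + s < 0 := by linarith [hs.2]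
      simp only [if_pos this, huw s ⟨hs.1.le, hs.2.le.trans hxh⟩, mul_assoc]
    have e2 : EqOn (fun s => kp * (g (x + s) * u s))
        (fun s => (if x + s < 0 then km else kp) * g (x + s) * w s) (uIoo (-x) h) := by
      intro s hs
      rw [uIoo_of_le hxh] at hs
      have : ¬ x + s < 0 := by linarith [hs.1]
      simp only [if_neg this, huw s ⟨hx0.trans hs.1.le, hs.2.le⟩, mul_assoc]
    rw [← intervalIntegral.integral_add_adjacent_intervals
        (((hint x 0 (-x)).const_mul km).congr_uIoo e1)
        (((hint x (-x) h).const_mul kp).congr_uIoo e2),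
      ← intervalIntegral.integral_congr_uIoo e1, ← intervalIntegral.integral_congr_uIoo e2,
      ← intervalIntegral.integral_add_adjacent_intervals (hint x 0 (-x)) (hint x (-x) h),
      intervalIntegral.integral_const_mul, intervalIntegral.integral_const_mul]
    ring
  have hVm := ((hF.const_mul kp).add (hG.const_mul (km - kp))).hasDerivWithinAt (s := Iic 0)
    |>.congr_of_eventuallyEq
      (by
        filter_upwards [self_mem_nhdsWithin,
          mem_nhdsWithin_of_mem_nhds (Ici_mem_nhds (neg_lt_zero.2 hh))] with x hx hx'
        exact hVneg x ⟨hx', hx⟩)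
      (hVneg 0 ⟨(neg_lt_zero.2 hh).le, le_rfl⟩)
  refine ⟨_, _, hVm, (hF.const_mul kp).hasDerivWithinAt.congr hVpos (hVpos 0 self_mem_Ici), ?_⟩
  rw [← huw 0 (left_mem_Icc.2 hh.le), add_zero]
  ring
end

section
/- (Existence of profiles for (M2), Case D1, Theorem 3.4.) Assume 0 < κ⁻ < κ⁺ and let ρ⁻, ρ⁺ ∈ (0,1) satisfy ρ⁻ < ρ̂ < ρ⁺ and f̄ := κ⁻ρ⁻v(ρ⁻) = κ⁺ρ⁺v(ρ⁺) > 0. Then the set of continuous functions P : ℝ → [0,1] satisfying P(x) · ∫₀^h κ(x+s)·v(P(x+s))·w(s) ds = f̄ for all x ∈ ℝ, together with lim_{x→−∞} P(x) = ρ⁻ and lim_{x→+∞} P(x) = ρ⁺, is infinite. -/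
open Set Filter Topology MeasureTheory

/-- A nonnegative bounded kernel on `(0, h]` with unit mass, continuous inside the interval. -/
structure IsKernel (h : ℝ) (w : ℝ → ℝ) : Prop where
  pos_h : 0 < h
  pos : ∀ x ∈ Ioo 0 h, 0 < w x
  right_eq : w h = 0
  cont : ContinuousOn w (Ioo 0 h)
  bdd : ∃ M, ∀ x, w x ≤ M
  int_eq : (∫ s in (0:ℝ)..h, w s) = 1

/-- A globally continuous nonincreasing velocity with values in `[0,1]`. -/
structure IsVelocity (v : ℝ → ℝ) : Prop where
  cont : Continuous v
  anti : Antitone v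
  nonneg : ∀ x, 0 ≤ v x
  le_one : ∀ x, v x ≤ 1

section Kernel

variable {h : ℝ} {w : ℝ → ℝ}

theorem IsKernel.nonneg (hw : IsKernel h w) {s : ℝ} (hs : s ∈ Ioc 0 h) : 0 ≤ w s := by
  rcases hs.2.lt_or_eq with hlt | rfl
  · exact (hw.pos s ⟨hs.1, hlt⟩).le
  · exact hw.right_eq.ge

theorem IsKernel.intervalIntegrable (hw : IsKernel h w) : IntervalIntegrable w volume 0 h := by
  by_contra hn
  have := intervalIntegral.integral_undef hn
  rw [hw.int_eq] at this
  exact one_ne_zero this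

theorem IsKernel.intervalIntegrable_mul (hw : IsKernel h w) {g : ℝ → ℝ} {C : ℝ}
    (hg : Measurable g) (hC : ∀ s, |g s| ≤ C) :
    IntervalIntegrable (fun s => g s * w s) volume 0 h := by
  rw [intervalIntegrable_iff_integrableOn_Ioc_of_le hw.pos_h.le]
  have := (intervalIntegrable_iff_integrableOn_Ioc_of_le hw.pos_h.le).1 hw.intervalIntegrable
  exact this.bdd_mul hg.aestronglyMeasurable (ae_of_all _ hC)

theorem IsKernel.intervalIntegrable_cont_mul (hw : IsKernel h w) {g : ℝ → ℝ}
    (hg : Continuous g) : IntervalIntegrable (fun s => g s * w s) volume 0 h :=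
  hw.intervalIntegrable.continuousOn_mul hg.continuousOn

theorem IsKernel.integral_mono (hw : IsKernel h w) {f g : ℝ → ℝ}
    (hf : IntervalIntegrable (fun s => f s * w s) volume 0 h)
    (hg : IntervalIntegrable (fun s => g s * w s) volume 0 h)
    (hfg : ∀ s ∈ Ioc 0 h, f s ≤ g s) :
    (∫ s in (0:ℝ)..h, f s * w s) ≤ ∫ s in (0:ℝ)..h, g s * w s := by
  rw [intervalIntegral.integral_of_le hw.pos_h.le, intervalIntegral.integral_of_le hw.pos_h.le]
  refine setIntegral_mono_on hf.1 hg.1 measurableSet_Ioc fun s hs => ?_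
  exact mul_le_mul_of_nonneg_right (hfg s hs) (hw.nonneg hs)

theorem IsKernel.integral_const_mul (hw : IsKernel h w) (c : ℝ) :
    (∫ s in (0:ℝ)..h, c * w s) = c := by
  rw [intervalIntegral.integral_const_mul, hw.int_eq, mul_one]

theorem IsKernel.measurable_indicator (hw : IsKernel h w) :
    Measurable ((Ioc 0 h).indicator w) := by
  have : (Ioc 0 h).indicator w = (Ioo 0 h).piecewise w (fun _ => 0) := by
    ext s
    by_cases hs : s ∈ Ioo 0 h
    · rw [piecewise_eq_of_mem _ _ _ hs, indicator_of_mem (Ioo_subset_Ioc_self hs)]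
    · rw [piecewise_eq_of_notMem _ _ _ hs]
      by_cases hs' : s ∈ Ioc 0 h
      · have : s = h := le_antisymm hs'.2 (not_lt.1 fun hlt => hs ⟨hs'.1, hlt⟩)
        rw [indicator_of_mem hs', this, hw.right_eq]
      · rw [indicator_of_notMem hs']
  rw [this]
  exact hw.cont.measurable_piecewise continuousOn_const measurableSet_Ioo

theorem IsKernel.continuousAt_indicator (hw : IsKernel h w) {s : ℝ} (h0 : s ≠ 0) (h1 : s ≠ h) :
    ContinuousAt ((Ioc 0 h).indicator w) s := by
  by_cases hs : s ∈ Ioo 0 h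
  · refine (hw.cont.continuousAt (Ioo_mem_nhds hs.1 hs.2)).congr ?_
    filter_upwards [Ioo_mem_nhds hs.1 hs.2] with t ht
    rw [indicator_of_mem (Ioo_subset_Ioc_self ht)]
  · have hmem : (Icc 0 h)ᶜ ∈ 𝓝 s := isClosed_Icc.isOpen_compl.mem_nhds fun hs' =>
      hs ⟨lt_of_le_of_ne hs'.1 h0.symm, lt_of_le_of_ne hs'.2 h1⟩
    refine (continuousAt_const (y := (0:ℝ))).congr ?_
    filter_upwards [hmem] with t ht
    rw [indicator_of_notMem fun ht' => ht (Ioc_subset_Icc_self ht')]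

/-- The average of a bounded measurable function against a translated kernel is continuous. -/
theorem IsKernel.continuous_average (hw : IsKernel h w) {g : ℝ → ℝ} {C : ℝ}
    (hg : Measurable g) (hC : ∀ y, |g y| ≤ C) :
    Continuous fun x => ∫ s in (0:ℝ)..h, g (x + s) * w s := by
  obtain ⟨M, hM⟩ := hw.bdd
  have hC0 : 0 ≤ C := (abs_nonneg _).trans (hC 0)
  have hM0 : 0 ≤ M := hw.right_eq ▸ hM h
  set W := (Ioc 0 h).indicator w with hW
  have hWM : ∀ s, |W s| ≤ M := fun s => by
    by_cases hs : s ∈ Ioc 0 h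
    · rw [hW, indicator_of_mem hs, abs_of_nonneg (hw.nonneg hs)]
      exact hM s
    · rw [hW, indicator_of_notMem hs, abs_zero]
      exact hM0
  have hrepr : (fun x => ∫ s in (0:ℝ)..h, g (x + s) * w s) = fun x => ∫ y, g y * W (y - x) := by
    ext x
    rw [intervalIntegral.integral_of_le hw.pos_h.le, ← integral_indicator measurableSet_Ioc,
      ← integral_sub_right_eq_self _ x]
    congr 1
    ext y
    by_cases hy : y - x ∈ Ioc 0 h
    · simp [hW, indicator_of_mem hy]
    · simp [hW, indicator_of_notMem hy]
  rw [hrepr, continuous_iff_continuousAt]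
  intro x₀
  refine continuousAt_of_dominated
    (bound := (Icc (x₀ - 1) (x₀ + h + 1)).indicator fun _ => C * M) ?_ ?_ ?_ ?_
  · exact Eventually.of_forall fun x => (hg.mul
      (hw.measurable_indicator.comp (measurable_id.sub_const x))).aestronglyMeasurable
  · filter_upwards [Ioo_mem_nhds (sub_one_lt x₀) (lt_add_one x₀)] with x hx
    refine ae_of_all _ fun y => ?_
    by_cases hy : y ∈ Icc (x₀ - 1) (x₀ + h + 1)
    · rw [indicator_of_mem hy, norm_mul]
      exact mul_le_mul (hC y) (hWM _) (norm_nonneg _) hC0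
    · have : y - x ∉ Ioc 0 h := fun hyx =>
        hy ⟨by linarith [hyx.1, hx.1], by linarith [hyx.2, hx.2]⟩
      rw [indicator_of_notMem hy, hW, indicator_of_notMem this]
      simp
  · rw [integrable_indicator_iff measurableSet_Icc]
    exact integrableOn_const (by simp)
  · have : ∀ a : ℝ, ∀ᵐ y : ℝ, y ≠ a := fun a => by
      simp [ae_iff]
    filter_upwards [this x₀, this (x₀ + h)] with y hy0 hy1
    refine continuousAt_const.mul ?_
    have : ContinuousAt W (y - x₀) :=
      hw.continuousAt_indicator (sub_ne_zero.2 hy0) fun hh => hy1 (by linarith)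
    exact ContinuousAt.comp (f := fun x => y - x) this (by fun_prop)

end Kernel

section Operator

variable {h km kp : ℝ} {w v : ℝ → ℝ}

theorem kappa_pos (hkm : 0 < km) (hkp : 0 < kp) (x : ℝ) : 0 < kappa km kp x := by
  unfold kappa
  split_ifs <;> assumption

theorem measurable_kappa : Measurable (kappa km kp) :=
  Measurable.ite measurableSet_Iio measurable_const measurable_const

theorem abs_kappa_mul_le (hkm : 0 < km) (hkp : 0 < kp) (hv : IsVelocity v) (x p : ℝ) :
    |kappa km kp x * v p| ≤ km + kp := by
  have hk : kappa km kp x ≤ km + kp := by unfold kappa; split_ifs <;> linarith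
  rw [abs_of_nonneg (mul_nonneg (kappa_pos hkm hkp x).le (hv.nonneg p))]
  nlinarith [hv.le_one p, hv.nonneg p, kappa_pos hkm hkp x]

theorem avgVel_integrable (hw : IsKernel h w) (hv : IsVelocity v) (hkm : 0 < km) (hkp : 0 < kp)
    {P : ℝ → ℝ} (hP : Measurable P) (x : ℝ) :
    IntervalIntegrable (fun s => kappa km kp (x + s) * v (P (x + s)) * w s) volume 0 h :=
  hw.intervalIntegrable_mul (g := fun s => kappa km kp (x + s) * v (P (x + s)))
    ((measurable_kappa.comp (measurable_const_add x)).mul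
      (hv.cont.measurable.comp (hP.comp (measurable_const_add x))))
    fun _ => abs_kappa_mul_le hkm hkp hv _ _

theorem continuous_avgVel (hw : IsKernel h w) (hv : IsVelocity v) (hkm : 0 < km) (hkp : 0 < kp)
    {P : ℝ → ℝ} (hP : Measurable P) : Continuous (avgVel h w v km kp P) :=
  hw.continuous_average (g := fun y => kappa km kp y * v (P y))
    (measurable_kappa.mul (hv.cont.measurable.comp hP)) fun _ => abs_kappa_mul_le hkm hkp hv _ _

theorem avgVel_anti (hw : IsKernel h w) (hv : IsVelocity v) (hkm : 0 < km) (hkp : 0 < kp)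
    {P R : ℝ → ℝ} (hP : Measurable P) (hR : Measurable R) (hPR : ∀ x, P x ≤ R x) (x : ℝ) :
    avgVel h w v km kp R x ≤ avgVel h w v km kp P x :=
  hw.integral_mono (avgVel_integrable hw hv hkm hkp hR x) (avgVel_integrable hw hv hkm hkp hP x)
    fun _ _ => mul_le_mul_of_nonneg_left (hv.anti (hPR _)) (kappa_pos hkm hkp _).le

theorem le_avgVel (hw : IsKernel h w) (hv : IsVelocity v) (hkm : 0 < km) (hkp : 0 < kp)
    {P : ℝ → ℝ} (hP : Measurable P) {x c : ℝ}
    (hc : ∀ s ∈ Ioc 0 h, c ≤ kappa km kp (x + s) * v (P (x + s))) :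
    c ≤ avgVel h w v km kp P x := by
  rw [← hw.integral_const_mul c]
  exact hw.integral_mono (hw.intervalIntegrable.const_mul c)
    (avgVel_integrable hw hv hkm hkp hP x) hc

theorem avgVel_le (hw : IsKernel h w) (hv : IsVelocity v) (hkm : 0 < km) (hkp : 0 < kp)
    {P : ℝ → ℝ} (hP : Measurable P) {x c : ℝ}
    (hc : ∀ s ∈ Ioc 0 h, kappa km kp (x + s) * v (P (x + s)) ≤ c) :
    avgVel h w v km kp P x ≤ c := by
  rw [← hw.integral_const_mul c]
  exact hw.integral_mono (avgVel_integrable hw hv hkm hkp hP x)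
    (hw.intervalIntegrable.const_mul c) hc

theorem avgVel_pos (hw : IsKernel h w) (hv : IsVelocity v) (hkm : 0 < km) (hkp : 0 < kp)
    {P : ℝ → ℝ} (hP : Measurable P) {r : ℝ} (hr : 0 < v r) (hPr : ∀ x, P x ≤ r) (x : ℝ) :
    0 < avgVel h w v km kp P x := by
  refine (mul_pos (lt_min hkm hkp) hr).trans_le (le_avgVel hw hv hkm hkp hP fun s _ => ?_)
  refine mul_le_mul ?_ (hv.anti (hPr _)) hr.le (kappa_pos hkm hkp _).le
  unfold kappa
  split_ifs
  · exact min_le_left _ _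
  · exact min_le_right _ _

theorem avgVel_tendsto (hw : IsKernel h w) (hv : IsVelocity v) (hkm : 0 < km) (hkp : 0 < kp)
    {R : ℕ → ℝ → ℝ} {P : ℝ → ℝ} (hR : ∀ n, Measurable (R n))
    (hRP : ∀ x, Tendsto (fun n => R n x) atTop (𝓝 (P x))) (x : ℝ) :
    Tendsto (fun n => avgVel h w v km kp (R n) x) atTop (𝓝 (avgVel h w v km kp P x)) := by
  refine intervalIntegral.tendsto_integral_filter_of_dominated_convergence
    (fun s => (km + kp) * |w s|) ?_ ?_ ?_ ?_
  · refine Eventually.of_forall fun n => ?_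
    rw [uIoc_of_le hw.pos_h.le]
    exact (avgVel_integrable hw hv hkm hkp (hR n) x).1.aestronglyMeasurable
  · refine Eventually.of_forall fun n => ae_of_all _ fun s _ => ?_
    rw [norm_mul]
    exact mul_le_mul_of_nonneg_right (abs_kappa_mul_le hkm hkp hv _ _) (norm_nonneg _)
  · exact hw.intervalIntegrable.abs.const_mul _
  · exact ae_of_all _ fun s _ => (((hv.cont.tendsto _).comp (hRP _)).const_mul _).mul_const _

theorem avgVel_anti_of_monotone (hw : IsKernel h w) (hv : IsVelocity v) (hkp : 0 < kp)
    {P : ℝ → ℝ} (hP : Monotone P) : Antitone (avgVel h w v kp kp P) := fun x y hxy =>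
  hw.integral_mono (avgVel_integrable hw hv hkp hkp hP.measurable y)
    (avgVel_integrable hw hv hkp hkp hP.measurable x) fun s _ => by
      simp only [kappa, ite_self]
      exact mul_le_mul_of_nonneg_left (hv.anti (hP (by linarith))) hkp.le

/-- Monotone iteration between a sub- and a supersolution. -/
theorem exists_solution_between (hw : IsKernel h w) (hv : IsVelocity v) (hkm : 0 < km)
    (hkp : 0 < kp) {c r : ℝ} (hc : 0 < c) (hr : 0 < v r) {L U : ℝ → ℝ} (hLm : Measurable L)
    (hUm : Measurable U) (hLU : ∀ x, L x ≤ U x) (hUr : ∀ x, U x ≤ r)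
    (hL : ∀ x, L x * avgVel h w v km kp L x ≤ c) (hU : ∀ x, c ≤ U x * avgVel h w v km kp U x) :
    ∃ P : ℝ → ℝ, Continuous P ∧ (∀ x, L x ≤ P x) ∧ (∀ x, P x ≤ U x) ∧
      (∀ x, P x * avgVel h w v km kp P x = c) ∧ (km = kp → Monotone L → Monotone P) := by
  set A := avgVel h w v km kp with hA
  set T : (ℝ → ℝ) → ℝ → ℝ := fun P x => c / A P x with hT
  have hTm : ∀ P, Measurable P → Measurable (T P) := fun P hP =>
    measurable_const.div (continuous_avgVel hw hv hkm hkp hP).measurable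
  have hpos : ∀ P, Measurable P → (∀ x, P x ≤ U x) → ∀ x, 0 < A P x := fun P hP hPU x =>
    avgVel_pos hw hv hkm hkp hP hr (fun y => (hPU y).trans (hUr y)) x
  have hmono : ∀ P R, Measurable P → Measurable R → (∀ x, R x ≤ U x) → (∀ x, P x ≤ R x) →
      ∀ x, T P x ≤ T R x := fun P R hP hR hRU hPR x =>
    div_le_div_of_nonneg_left hc.le (hpos R hR hRU x) (avgVel_anti hw hv hkm hkp hP hR hPR x)
  have hTU : ∀ x, T U x ≤ U x := fun x =>
    (div_le_iff₀ (hpos U hUm (fun _ => le_rfl) x)).2 (hU x)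
  have hTL : ∀ x, L x ≤ T L x := fun x => (le_div_iff₀ (hpos L hLm hLU x)).2 (hL x)
  set R : ℕ → ℝ → ℝ := fun n => T^[n] L with hR
  have hsucc : ∀ n, R (n + 1) = T (R n) := fun n => Function.iterate_succ_apply' T n L
  have key : ∀ n, Measurable (R n) ∧ (∀ x, R n x ≤ U x) ∧ ∀ x, R n x ≤ R (n + 1) x := by
    intro n
    induction n with
    | zero => exact ⟨hLm, hLU, hTL⟩
    | succ n ih =>
      obtain ⟨h1, h2, h3⟩ := ih
      have h4 : Measurable (R (n + 1)) := hsucc n ▸ hTm _ h1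
      have h5 : ∀ x, R (n + 1) x ≤ U x := fun x => by
        rw [hsucc n]
        exact (hmono _ _ h1 hUm (fun _ => le_rfl) h2 x).trans (hTU x)
      refine ⟨h4, h5, fun x => ?_⟩
      have := hmono _ _ h1 h4 h5 h3 x
      rwa [← hsucc, ← hsucc] at this
  have hRmono : ∀ x, Monotone fun n => R n x := fun x =>
    monotone_nat_of_le_succ fun n => (key n).2.2 x
  have hbdd : ∀ x, BddAbove (range fun n => R n x) := fun x =>
    ⟨U x, forall_mem_range.2 fun n => (key n).2.1 x⟩
  set P : ℝ → ℝ := fun x => ⨆ n, R n x with hP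
  have hlim : ∀ x, Tendsto (fun n => R n x) atTop (𝓝 (P x)) := fun x =>
    tendsto_atTop_ciSup (hRmono x) (hbdd x)
  have hPm : Measurable P :=
    measurable_of_tendsto_metrizable (fun n => (key n).1) (tendsto_pi_nhds.2 hlim)
  have hPU : ∀ x, P x ≤ U x := fun x => ciSup_le fun n => (key n).2.1 x
  have hfix : ∀ x, P x = c / A P x := fun x => by
    refine tendsto_nhds_unique ((tendsto_add_atTop_iff_nat 1).2 (hlim x)) ?_
    simp only [hsucc]
    exact tendsto_const_nhds.div (avgVel_tendsto hw hv hkm hkp (fun n => (key n).1) hlim x)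
      (hpos P hPm hPU x).ne'
  refine ⟨P, ?_, fun x => le_ciSup (hbdd x) 0, hPU, fun x => ?_, fun hk hLmono => ?_⟩
  · rw [funext hfix]
    exact continuous_const.div (continuous_avgVel hw hv hkm hkp hPm)
      fun x => (hpos P hPm hPU x).ne'
  · rw [← eq_div_iff (hpos P hPm hPU x).ne']
    exact hfix x
  · have hRn : ∀ n, Monotone (R n) := fun n => by
      induction n with
      | zero => exact hLmono
      | succ n ih =>
        rw [hsucc]
        refine fun x y hxy => div_le_div_of_nonneg_left hc.le
          (hpos _ (key n).1 (key n).2.1 y) ?_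
        rw [hA]
        subst hk
        exact avgVel_anti_of_monotone hw hv hkp ih hxy
    exact fun x y hxy => ciSup_mono (hbdd y) fun n => hRn n hxy

end Operator

section Barriers

variable {h : ℝ} {w v : ℝ → ℝ}

/-- The Laplace transform of the kernel. -/
noncomputable def kernelLaplace (h : ℝ) (w : ℝ → ℝ) (l : ℝ) : ℝ :=
  ∫ s in (0:ℝ)..h, Real.exp (-(l * s)) * w s

theorem IsKernel.exists_kernelLaplace_eq (hw : IsKernel h w) {t : ℝ} (ht : t ∈ Ioo 0 1) :
    ∃ l > 0, kernelLaplace h w l = t := by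
  have hae : AEStronglyMeasurable w (volume.restrict (uIoc 0 h)) := by
    rw [uIoc_of_le hw.pos_h.le]
    exact hw.intervalIntegrable.1.aestronglyMeasurable
  have hmeas : ∀ l : ℝ, AEStronglyMeasurable (fun s => Real.exp (-(|l| * s)) * w s)
      (volume.restrict (uIoc 0 h)) := fun l =>
    (by fun_prop : Continuous fun s => Real.exp (-(|l| * s))).aestronglyMeasurable.mul hae
  have hbound : ∀ l : ℝ, ∀ s ∈ uIoc 0 h, ‖Real.exp (-(|l| * s)) * w s‖ ≤ |w s| := by
    intro l s hs
    rw [uIoc_of_le hw.pos_h.le] at hs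
    rw [norm_mul, Real.norm_eq_abs, Real.abs_exp]
    refine mul_le_of_le_one_left (norm_nonneg _) (Real.exp_le_one_iff.2 ?_)
    have := mul_nonneg (abs_nonneg l) hs.1.le
    linarith
  have hcont : Continuous fun l => kernelLaplace h w |l| :=
    intervalIntegral.continuous_of_dominated_interval (bound := fun s => |w s|) hmeas
      (fun l => ae_of_all _ (hbound l)) hw.intervalIntegrable.abs
      (ae_of_all _ fun s _ => by fun_prop)
  have hlim : Tendsto (fun l => kernelLaplace h w |l|) atTop (𝓝 0) := by
    have : Tendsto (fun l : ℝ => ∫ s in (0:ℝ)..h, Real.exp (-(|l| * s)) * w s) atTop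
        (𝓝 (∫ _ in (0:ℝ)..h, (0:ℝ))) := by
      refine intervalIntegral.tendsto_integral_filter_of_dominated_convergence (fun s => |w s|)
        (Eventually.of_forall hmeas) (Eventually.of_forall fun l => ae_of_all _ (hbound l))
        hw.intervalIntegrable.abs (ae_of_all _ fun s hs => ?_)
      rw [uIoc_of_le hw.pos_h.le] at hs
      have h1 : Tendsto (fun l : ℝ => Real.exp (-(|l| * s))) atTop (𝓝 0) :=
        Real.tendsto_exp_neg_atTop_nhds_zero.comp
          (tendsto_abs_atTop_atTop.atTop_mul_const hs.1)
      simpa using h1.mul_const (w s)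
    simpa [kernelLaplace] using this
  have hzero : kernelLaplace h w |0| = 1 := by
    simpa [kernelLaplace] using hw.int_eq
  obtain ⟨B, hBt, hB0⟩ := ((hlim.eventually_lt_const ht.1).and (eventually_ge_atTop 0)).exists
  obtain ⟨l, hl, hlt⟩ := intermediate_value_Icc' hB0 hcont.continuousOn
    (show t ∈ Icc _ _ from ⟨hBt.le, by rw [hzero]; exact ht.2.le⟩)
  have hl0 : l ≠ 0 := by
    rintro rfl
    simp only [hzero] at hlt
    exact ht.2.ne' hlt
  exact ⟨|l|, abs_pos.2 hl0, hlt⟩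

theorem IsKernel.kernelLaplace_lt (hw : IsKernel h w) {l m : ℝ} (hlm : l < m) :
    kernelLaplace h w m < kernelLaplace h w l := by
  have hint : ∀ l : ℝ, IntervalIntegrable (fun s => Real.exp (-(l * s)) * w s) volume 0 h :=
    fun l => hw.intervalIntegrable_cont_mul (by fun_prop)
  rw [← sub_pos, kernelLaplace, kernelLaplace, ← intervalIntegral.integral_sub (hint l) (hint m)]
  refine intervalIntegral.intervalIntegral_pos_of_pos_on ((hint l).sub (hint m))
    (fun s hs => ?_) hw.pos_h
  rw [← sub_mul]
  refine mul_pos (sub_pos.2 (Real.exp_lt_exp.2 ?_)) (hw.pos s hs)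
  have := mul_lt_mul_of_pos_right hlm hs.1
  linarith

theorem IsKernel.kernelLaplace_nonneg (hw : IsKernel h w) (l : ℝ) : 0 ≤ kernelLaplace h w l := by
  have := hw.integral_mono (f := fun _ => 0) (g := fun s => Real.exp (-(l * s)))
    (hw.intervalIntegrable_cont_mul continuous_const)
    (hw.intervalIntegrable_cont_mul (by fun_prop)) fun _ _ => (Real.exp_pos _).le
  simpa [kernelLaplace] using this

theorem IsKernel.integral_exp_combination (hw : IsKernel h w) (a b c l m : ℝ) :
    (∫ s in (0:ℝ)..h, (a + b * Real.exp (-(l * s)) + c * Real.exp (-(m * s))) * w s)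
      = a + b * kernelLaplace h w l + c * kernelLaplace h w m := by
  have hint : ∀ l : ℝ, IntervalIntegrable (fun s => Real.exp (-(l * s)) * w s) volume 0 h :=
    fun l => hw.intervalIntegrable_cont_mul (by fun_prop)
  have h1 := intervalIntegral.integral_add
    ((hw.intervalIntegrable.const_mul a).add ((hint l).const_mul b)) ((hint m).const_mul c)
  have h2 := intervalIntegral.integral_add
    (hw.intervalIntegrable.const_mul a) ((hint l).const_mul b)
  rw [intervalIntegral.integral_congr (g := fun s => a * w s + b * (Real.exp (-(l * s)) * w s)
    + c * (Real.exp (-(m * s)) * w s)) fun s _ => by ring]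
  rw [h1, h2, hw.integral_const_mul, intervalIntegral.integral_const_mul,
    intervalIntegral.integral_const_mul, kernelLaplace, kernelLaplace]

/-- A monotone solution on a homogeneous road, joining a lower state to `rp`. -/
theorem exists_homogeneous_profile (hw : IsKernel h w) (hv : IsVelocity v) {kp rp b C : ℝ}
    (hkp : 0 < kp) (hrp : 0 < rp) (hvp : 0 < v rp) (hb : v rp < rp * b) (hC : 0 ≤ C)
    (hupper : ∀ p ∈ Icc 0 rp, v p ≤ v rp + b * (rp - p))
    (hlower : ∀ z ∈ Icc 0 rp, v rp + b * z - C * z ^ 2 ≤ v (rp - z)) :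
    ∃ Q : ℝ → ℝ, Continuous Q ∧ Monotone Q ∧ (∀ x, 0 ≤ Q x) ∧ (∀ x, Q x ≤ rp) ∧
      (∀ x, Q x * avgVel h w v kp kp Q x = kp * (rp * v rp)) ∧ Tendsto Q atTop (𝓝 rp) ∧
      ∃ q < rp, ∀ᶠ x in atBot, Q x ≤ q := by
  have hb0 : 0 < b := by
    by_contra hn
    nlinarith [not_lt.1 hn]
  obtain ⟨l, hl, hlap⟩ := hw.exists_kernelLaplace_eq (t := v rp / (rp * b))
    ⟨div_pos hvp (mul_pos hrp hb0), (div_lt_one (mul_pos hrp hb0)).2 hb⟩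
  set w1 := kernelLaplace h w l with hw1
  set w2 := kernelLaplace h w (2 * l) with hw2
  have hw21 : w2 < w1 := hw.kernelLaplace_lt (by linarith)
  have hw2n : 0 ≤ w2 := hw.kernelLaplace_nonneg _
  have hvw : v rp = rp * b * w1 := by
    rw [hlap]
    field_simp
  obtain ⟨K, hK0, hKrp, hK⟩ : ∃ K > 0, 1 / (4 * K) ≤ rp ∧
      b * w1 + rp * C * w2 ≤ K * (b * rp * (w1 - w2)) := by
    have hd : 0 < b * rp * (w1 - w2) := mul_pos (mul_pos hb0 hrp) (sub_pos.2 hw21)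
    refine ⟨max (1 / rp) ((b * w1 + rp * C * w2) / (b * rp * (w1 - w2))),
      lt_max_of_lt_left (by positivity), ?_, ?_⟩
    · rw [div_le_iff₀ (by positivity)]
      have := mul_le_mul_of_nonneg_left
        (le_max_left (1 / rp) ((b * w1 + rp * C * w2) / (b * rp * (w1 - w2)))) hrp.le
      rw [mul_one_div_cancel hrp.ne'] at this
      linarith
    · rw [← div_le_iff₀ hd]
      exact le_max_right _ _
  set y : ℝ → ℝ := fun x => Real.exp (-(l * x)) with hy
  have hyc : Continuous y := by fun_prop
  have hypos : ∀ x, 0 < y x := fun x => Real.exp_pos _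
  have hyadd : ∀ x s, y (x + s) = y x * Real.exp (-(l * s)) := fun x s => by
    rw [hy, ← Real.exp_add]
    ring_nf
  have hyanti : Antitone y := fun a c hac =>
    Real.exp_le_exp.2 (neg_le_neg (mul_le_mul_of_nonneg_left hac hl.le))
  set L : ℝ → ℝ := fun x => max (rp - y x) 0 with hL
  set τ : ℝ → ℝ := fun x => min (y x) (1 / (2 * K)) with hτ
  set U : ℝ → ℝ := fun x => rp - (τ x - K * τ x ^ 2) with hU
  have hLmono : Monotone L := fun a c hac =>
    max_le_max (sub_le_sub_left (hyanti hac) _) le_rfl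
  have hτc : Continuous τ := hyc.min continuous_const
  have hUc : Continuous U := by fun_prop
  have hKK : K * (1 / (2 * K)) = 1 / 2 := by field_simp
  have hKτ : ∀ x, K * τ x ≤ 1 / 2 := fun x =>
    hKK ▸ mul_le_mul_of_nonneg_left (min_le_right _ _) hK0.le
  have hτpos : ∀ x, 0 < τ x := fun x => lt_min (hypos x) (by positivity)
  have hquart : ∀ z : ℝ, z - K * z ^ 2 ≤ 1 / (4 * K) := fun z => by
    rw [le_div_iff₀ (by positivity)]
    nlinarith [sq_nonneg (2 * K * z - 1)]
  have hUle : ∀ x, U x ≤ rp := fun x => by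
    have := mul_nonneg (hτpos x).le (by linarith [hKτ x] : 0 ≤ 1 - K * τ x)
    simp only [hU]
    nlinarith
  have hLU : ∀ x, L x ≤ U x := fun x => by
    refine max_le ?_ ?_
    · have := min_le_left (y x) (1 / (2 * K))
      simp only [hU]
      nlinarith [mul_nonneg hK0.le (sq_nonneg (τ x))]
    · simp only [hU]
      linarith [hquart (τ x)]
  have hc0 : 0 < kp * (rp * v rp) := by positivity
  have hLsub : ∀ x, L x * avgVel h w v kp kp L x ≤ kp * (rp * v rp) := fun x => by
    rcases le_total (rp - y x) 0 with hx | hx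
    · simp only [hL, max_eq_right hx, zero_mul]
      exact hc0.le
    · have hA : avgVel h w v kp kp L x ≤ kp * v rp + kp * (b * y x) * w1 + 0 * w1 := by
        rw [hw1, ← hw.integral_exp_combination]
        refine hw.integral_mono (avgVel_integrable hw hv hkp hkp hLmono.measurable x)
          (hw.intervalIntegrable_cont_mul (by fun_prop)) fun s _ => ?_
        have h1 : v (L (x + s)) ≤ v rp + b * (rp - L (x + s)) :=
          hupper _ ⟨le_max_right _ _, (hLU _).trans (hUle _)⟩
        have h2 : rp - L (x + s) ≤ y x * Real.exp (-(l * s)) := by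
          rw [← hyadd]
          linarith [le_max_left (rp - y (x + s)) 0]
        have h3 := h1.trans (add_le_add_right (mul_le_mul_of_nonneg_left h2 hb0.le) _)
        simp only [kappa, ite_self]
        nlinarith [mul_le_mul_of_nonneg_left h3 hkp.le]
      have hLx : L x = rp - y x := max_eq_left hx
      rw [hLx]
      refine (mul_le_mul_of_nonneg_left hA hx).trans ?_
      have h1 : 0 ≤ kp * (b * w1 * (y x) ^ 2) := by
        have : 0 ≤ w1 := hw2n.trans hw21.le
        positivity
      rw [hvw]
      linarith
  have hUsup : ∀ x, kp * (rp * v rp) ≤ U x * avgVel h w v kp kp U x := fun x => by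
    have hA : kp * v rp + kp * (b * τ x) * w1 + (-(kp * ((b * K + C) * τ x ^ 2))) * w2
        ≤ avgVel h w v kp kp U x := by
      rw [hw1, hw2, ← hw.integral_exp_combination]
      refine hw.integral_mono (hw.intervalIntegrable_cont_mul (by fun_prop))
        (avgVel_integrable hw hv hkp hkp hUc.measurable x) fun s hs => ?_
      set e := Real.exp (-(l * s)) with he
      have he0 : 0 < e := Real.exp_pos _
      have he1 : e ≤ 1 := Real.exp_le_one_iff.2 (by nlinarith [hs.1])
      have he2 : Real.exp (-(2 * l * s)) = e ^ 2 := by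
        rw [he, ← Real.exp_nat_mul]
        ring_nf
      set z := τ x * e with hz
      have hz0 : 0 < z := mul_pos (hτpos x) he0
      have hzτ : z ≤ τ x := mul_le_of_le_one_right (hτpos x).le he1
      have hzτs : z ≤ τ (x + s) := by
        refine le_min ?_ (hzτ.trans (min_le_right _ _))
        rw [hyadd]
        exact mul_le_mul_of_nonneg_right (min_le_left _ _) he0.le
      have hKz : K * z ≤ 1 / 2 := (mul_le_mul_of_nonneg_left hzτ hK0.le).trans (hKτ x)
      set d := z - K * z ^ 2 with hd
      have hd0 : 0 ≤ d := by nlinarith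
      have hdz : d ≤ z := by nlinarith
      have h1 : U (x + s) ≤ rp - d := by
        simp only [hU, hd]
        nlinarith [hKτ (x + s), mul_nonneg (sub_nonneg.2 hzτs)
          (by linarith [hKτ (x + s)] : 0 ≤ 1 - K * z - K * τ (x + s))]
      have h2 := (hlower d ⟨hd0, (hquart z).trans hKrp⟩).trans (hv.anti h1)
      have h3 : C * d ^ 2 ≤ C * z ^ 2 :=
        mul_le_mul_of_nonneg_left (pow_le_pow_left₀ hd0 hdz 2) hC
      have h4 : v rp + b * z - (b * K + C) * z ^ 2 ≤ v (U (x + s)) := by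
        simp only [hd] at h2 h3
        linarith
      simp only [kappa, ite_self]
      rw [he2]
      have h5 := mul_le_mul_of_nonneg_left h4 hkp.le
      simp only [hz] at h5
      linarith
    have hUx0 : 0 ≤ U x := by
      simp only [hU]
      linarith [hquart (τ x)]
    refine le_trans ?_ (mul_le_mul_of_nonneg_left hA hUx0)
    set t := τ x with ht
    have ht0 : 0 < t := hτpos x
    have h1 : 0 ≤ t ^ 2 * (K * (b * rp * (w1 - w2)) - (b * w1 + rp * C * w2)) :=
      mul_nonneg (sq_nonneg _) (sub_nonneg.2 hK)
    have h2 : 0 ≤ (b * K + C) * w2 * t ^ 3 * (1 - K * t) :=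
      mul_nonneg (by positivity) (by linarith [hKτ x])
    have h3 : 0 ≤ K * b * w1 * t ^ 3 := by
      have : 0 ≤ w1 := hw2n.trans hw21.le
      positivity
    have h4 : kp * (rp * v rp) + kp * (t ^ 2 * (K * (b * rp * (w1 - w2)) - (b * w1 + rp * C * w2))
        + (b * K + C) * w2 * t ^ 3 * (1 - K * t) + K * b * w1 * t ^ 3)
        = U x * (kp * v rp + kp * (b * t) * w1 + (-(kp * ((b * K + C) * t ^ 2))) * w2) := by
      simp only [hU, ← ht]
      rw [hvw]
      ring
    rw [← h4]
    linarith [mul_nonneg hkp.le (add_nonneg (add_nonneg h1 h2) h3)]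
  obtain ⟨Q, hQc, hLQ, hQU, hQ, hQm⟩ := exists_solution_between hw hv hkp hkp hc0 hvp
    hLmono.measurable hUc.measurable hLU hUle hLsub hUsup
  have hylim : Tendsto y atTop (𝓝 0) :=
    Real.tendsto_exp_neg_atTop_nhds_zero.comp (tendsto_id.const_mul_atTop hl)
  refine ⟨Q, hQc, hQm rfl hLmono, fun x => (le_max_right _ _).trans (hLQ x),
    fun x => (hQU x).trans (hUle x), hQ, ?_, rp - 1 / (4 * K), ?_, ?_⟩
  · refine tendsto_of_tendsto_of_tendsto_of_le_of_le (g := fun x => rp - y x) ?_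
      tendsto_const_nhds (fun x => (le_max_left _ _).trans (hLQ x))
      (fun x => (hQU x).trans (hUle x))
    simpa using hylim.const_sub rp
  · have : 0 < 1 / (4 * K) := by positivity
    linarith
  · have hytop : Tendsto y atBot atTop :=
      Real.tendsto_exp_atTop.comp (tendsto_neg_atBot_atTop.comp (tendsto_id.const_mul_atBot hl))
    filter_upwards [hytop.eventually_ge_atTop (1 / (2 * K))] with x hx
    refine (hQU x).trans (le_of_eq ?_)
    have : τ x = 1 / (2 * K) := min_eq_right hx
    simp only [hU, this]
    field_simp
    ring

end Barriers

section RoughRoad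

variable {h km kp rm rp : ℝ} {w v : ℝ → ℝ}

theorem avgVel_const_sub (h : ℝ) (w v : ℝ → ℝ) (kp : ℝ) (Q : ℝ → ℝ) (a x : ℝ) :
    avgVel h w v kp kp (fun z => Q (z - a)) x = avgVel h w v kp kp Q (x - a) := by
  simp only [avgVel, kappa, ite_self, add_sub_right_comm]

/-- Backward convergence to the stable state on the left of the road discontinuity. -/
theorem tendsto_atBot_of_solution (hw : IsKernel h w) (hv : IsVelocity v) (hkm : 0 < km)
    (hkp : 0 < kp) (hvm : 0 < v rm)
    (hlow : ∀ l ∈ Icc 0 rm, rm * v rm ≤ l * v l → l = rm) {P : ℝ → ℝ} (hPc : Continuous P)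
    (hP0 : ∀ x, 0 ≤ P x) (hPm : ∀ x < 0, P x ≤ rm)
    (hP : ∀ x, P x * avgVel h w v km kp P x = km * (rm * v rm)) :
    Tendsto P atBot (𝓝 rm) := by
  have hev : ∀ᶠ x in atBot, P x ≤ rm := (eventually_lt_atBot 0).mono hPm
  have hbelow : IsBoundedUnder (· ≥ ·) atBot P :=
    isBoundedUnder_of_eventually_ge (a := 0) (Eventually.of_forall hP0)
  have habove : IsBoundedUnder (· ≤ ·) atBot P := isBoundedUnder_of_eventually_le hev
  set l := liminf P atBot with hl
  have hl0 : 0 ≤ l := le_liminf_of_le habove.isCoboundedUnder_ge (Eventually.of_forall hP0)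
  have hlm : l ≤ rm := by
    by_contra hn
    obtain ⟨x, h1, h2⟩ := ((eventually_lt_of_lt_liminf (not_le.1 hn) hbelow).and hev).exists
    exact absurd h2 (not_le.2 h1)
  have hstep : ∀ b < l, rm * v rm ≤ l * v b := fun b hb => by
    have hvb : 0 < v b := hvm.trans_le (hv.anti (hb.le.trans hlm))
    rw [← div_le_iff₀ hvb]
    obtain ⟨X, hX⟩ := eventually_atBot.1 (eventually_lt_of_lt_liminf hb hbelow)
    refine le_liminf_of_le habove.isCoboundedUnder_ge ?_
    filter_upwards [eventually_le_atBot (min X (-1) - h)] with x hx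
    have h1 := min_le_left X (-1)
    have h2 := min_le_right X (-1)
    have hA : avgVel h w v km kp P x ≤ km * v b :=
      avgVel_le hw hv hkm hkp hPc.measurable fun s hs => by
        rw [kappa, if_pos (by linarith [hs.2])]
        exact mul_le_mul_of_nonneg_left (hv.anti (hX _ (by linarith [hs.2])).le) hkm.le
    rw [div_le_iff₀ hvb]
    have := mul_le_mul_of_nonneg_left hA (hP0 x)
    rw [hP x] at this
    exact le_of_mul_le_mul_left (by linarith) hkm
  have hlim : rm * v rm ≤ l * v l :=
    ge_of_tendsto (((hv.cont.tendsto l).mono_left nhdsWithin_le_nhds).const_mul l)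
      ((eventually_mem_nhdsWithin (s := Iio l)).mono hstep)
  have hlrm : l = rm := hlow l ⟨hl0, hlm⟩ hlim
  refine tendsto_order.2 ⟨fun b hb => eventually_lt_of_lt_liminf (by rwa [← hl, hlrm]) hbelow,
    fun b hb => hev.mono fun x hx => hx.trans_lt hb⟩

/-- A homogeneous profile lying below `rm` near the discontinuity extends across it. -/
theorem exists_profile_extending (hw : IsKernel h w) (hv : IsVelocity v) (hkm : 0 < km)
    (hk : km < kp) (hrm : 0 < rm) (hrmp : rm < rp) (hvp : 0 < v rp)
    (hflux : km * (rm * v rm) = kp * (rp * v rp))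
    (hlow : ∀ l ∈ Icc 0 rm, rm * v rm ≤ l * v l → l = rm) {Q : ℝ → ℝ} (hQc : Continuous Q)
    (hQ0 : ∀ x, 0 ≤ Q x) (hQp : ∀ x, Q x ≤ rp) (hQm : ∀ x ≤ h, Q x ≤ rm)
    (hQ : ∀ x, Q x * avgVel h w v kp kp Q x = kp * (rp * v rp))
    (hQlim : Tendsto Q atTop (𝓝 rp)) :
    ∃ P : ℝ → ℝ, Continuous P ∧ (∀ x, P x ∈ Icc 0 rp) ∧
      (∀ x, P x * avgVel h w v km kp P x = kp * (rp * v rp)) ∧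
      Tendsto P atBot (𝓝 rm) ∧ Tendsto P atTop (𝓝 rp) ∧ ∀ x, 0 ≤ x → P x = Q x := by
  have hkp : 0 < kp := hkm.trans hk
  have hvm : 0 < v rm := hvp.trans_le (hv.anti hrmp.le)
  set U : ℝ → ℝ := fun x => if x < 0 then rm else Q x with hU
  have hUneg : ∀ x < 0, U x = rm := fun x hx => if_pos hx
  have hUpos : ∀ x, 0 ≤ x → U x = Q x := fun x hx => if_neg (not_lt.2 hx)
  have hUm : Measurable U := Measurable.ite measurableSet_Iio measurable_const hQc.measurable
  have hQU : ∀ x, Q x ≤ U x := fun x => by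
    rcases lt_or_ge x 0 with hx | hx
    · exact (hQm x (hx.le.trans hw.pos_h.le)).trans_eq (hUneg x hx).symm
    · exact (hUpos x hx).ge
  have hUr : ∀ x, U x ≤ rp := fun x => by
    rcases lt_or_ge x 0 with hx | hx
    · exact (hUneg x hx).trans_le hrmp.le
    · exact (hUpos x hx).trans_le (hQp x)
  have hUle : ∀ x < h, U x ≤ rm := fun x hxh => by
    rcases lt_or_ge x 0 with hx | hx
    · exact (hUneg x hx).le
    · exact (hUpos x hx).trans_le (hQm x hxh.le)
  have hkge : ∀ x, km ≤ kappa km kp x := fun x => by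
    unfold kappa
    split_ifs
    · exact le_rfl
    · exact hk.le
  have hkle : ∀ x, kappa km kp x ≤ kp := fun x => by
    unfold kappa
    split_ifs
    · exact hk.le
    · exact le_rfl
  have hsub : ∀ x, Q x * avgVel h w v km kp Q x ≤ kp * (rp * v rp) := fun x => by
    rw [← hQ x]
    refine mul_le_mul_of_nonneg_left (hw.integral_mono
      (avgVel_integrable hw hv hkm hkp hQc.measurable x)
      (avgVel_integrable hw hv hkp hkp hQc.measurable x) fun s _ => ?_) (hQ0 x)
    refine mul_le_mul_of_nonneg_right ?_ (hv.nonneg _)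
    rw [kappa, kappa, ite_self]
    exact hkle _
  have hsup : ∀ x, kp * (rp * v rp) ≤ U x * avgVel h w v km kp U x := fun x => by
    rcases lt_or_ge x 0 with hx | hx
    · rw [← hflux, hUneg x hx]
      have : km * v rm ≤ avgVel h w v km kp U x :=
        le_avgVel hw hv hkm hkp hUm fun s hs =>
          mul_le_mul (hkge _) (hv.anti (hUle _ (by linarith [hs.2]))) hvm.le
            (kappa_pos hkm hkp _).le
      linarith [mul_le_mul_of_nonneg_left this hrm.le]
    · have : avgVel h w v km kp U x = avgVel h w v kp kp Q x := by
        refine intervalIntegral.integral_congr fun s hs => ?_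
        rw [uIcc_of_le hw.pos_h.le] at hs
        have hxs : 0 ≤ x + s := add_nonneg hx hs.1
        simp only [hUpos _ hxs, kappa, ite_self, if_neg (not_lt.2 hxs)]
      rw [this, hUpos x hx, hQ x]
  obtain ⟨P, hPc, hQP, hPU, hP, -⟩ := exists_solution_between hw hv hkm hkp
    (mul_pos hkp (mul_pos (hrm.trans hrmp) hvp)) hvp hQc.measurable hUm hQU hUr hsub hsup
  have hPQ : ∀ x, 0 ≤ x → P x = Q x := fun x hx =>
    le_antisymm ((hPU x).trans_eq (hUpos x hx)) (hQP x)
  have hP0 : ∀ x, 0 ≤ P x := fun x => (hQ0 x).trans (hQP x)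
  refine ⟨P, hPc, fun x => ⟨hP0 x, (hPU x).trans (hUr x)⟩, hP, ?_, ?_, hPQ⟩
  · exact tendsto_atBot_of_solution hw hv hkm hkp hvm hlow hPc hP0
      (fun x hx => (hPU x).trans_eq (hUneg x hx)) fun x => (hP x).trans hflux.symm
  · exact hQlim.congr' ((eventually_ge_atTop 0).mono fun x hx => (hPQ x hx).symm)

theorem infinite_profiles (hw : IsKernel h w) (hv : IsVelocity v) (hkm : 0 < km)
    (hk : km < kp) (hrm : 0 < rm) (hrmp : rm < rp) (hvp : 0 < v rp)
    (hflux : km * (rm * v rm) = kp * (rp * v rp))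
    (hlow : ∀ l ∈ Icc 0 rm, rm * v rm ≤ l * v l → l = rm)
    (hmid : ∀ q ∈ Ico rm rp, rp * v rp < q * v q) {b C : ℝ} (hb : v rp < rp * b) (hC : 0 ≤ C)
    (hupper : ∀ p ∈ Icc 0 rp, v p ≤ v rp + b * (rp - p))
    (hlower : ∀ z ∈ Icc 0 rp, v rp + b * z - C * z ^ 2 ≤ v (rp - z)) :
    {P : ℝ → ℝ | Continuous P ∧ (∀ x, P x ∈ Icc 0 rp) ∧
      (∀ x, P x * avgVel h w v km kp P x = kp * (rp * v rp)) ∧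
      Tendsto P atBot (𝓝 rm) ∧ Tendsto P atTop (𝓝 rp)}.Infinite := by
  have hkp : 0 < kp := hkm.trans hk
  obtain ⟨Q, hQc, hQmono, hQ0, hQp, hQ, hQlim, q₁, hq₁, hQq₁⟩ :=
    exists_homogeneous_profile hw hv hkp (hrm.trans hrmp) hvp hb hC hupper hlower
  have hQbdd : BddBelow (range Q) := ⟨0, forall_mem_range.2 hQ0⟩
  set q := ⨅ x, Q x with hq
  have hqlim : Tendsto Q atBot (𝓝 q) := tendsto_atBot_ciInf hQmono hQbdd
  have hq0 : 0 ≤ q := le_ciInf hQ0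
  have hqp : q < rp := (le_of_tendsto hqlim hQq₁).trans_lt hq₁
  have hqflux : q * v q ≤ rp * v rp := by
    refine le_of_tendsto (((hv.cont.tendsto q).comp
      (hqlim.comp (tendsto_atBot_add_const_right _ h tendsto_id))).const_mul q)
      (Eventually.of_forall fun x => ?_)
    have h1 : kp * v (Q (x + h)) ≤ avgVel h w v kp kp Q x :=
      le_avgVel hw hv hkp hkp hQc.measurable fun s hs => by
        rw [kappa, ite_self]
        exact mul_le_mul_of_nonneg_left (hv.anti (hQmono (by linarith [hs.2]))) hkp.le
    have h2 : q * (kp * v (Q (x + h))) ≤ kp * (rp * v rp) := by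
      rw [← hQ x]
      exact mul_le_mul (ciInf_le hQbdd x) h1 (mul_nonneg hkp.le (hv.nonneg _)) (hQ0 x)
    refine le_of_mul_le_mul_left ?_ hkp
    simp only [Function.comp_apply, id_eq]
    linarith
  have hqm : q < rm := not_le.1 fun hle => (hmid q ⟨hle, hqp⟩).not_ge hqflux
  obtain ⟨x₁, hx₁⟩ := eventually_atBot.1 (hqlim.eventually_lt_const hqm)
  intro hfin
  have hev : ∀ᶠ x in atTop, ∀ P ∈ {P : ℝ → ℝ | Continuous P ∧ (∀ x, P x ∈ Icc 0 rp) ∧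
      (∀ x, P x * avgVel h w v km kp P x = kp * (rp * v rp)) ∧
      Tendsto P atBot (𝓝 rm) ∧ Tendsto P atTop (𝓝 rp)}, rm < P x :=
    (eventually_all_finite hfin).2 fun P hP => hP.2.2.2.2.eventually_const_lt hrmp
  obtain ⟨X, hX, hX0⟩ := (hev.and (eventually_ge_atTop 0)).exists
  set a := max X h - x₁ with ha
  have hle : ∀ x ≤ max X h, Q (x - a) ≤ rm := fun x hx => (hx₁ _ (by linarith)).le
  obtain ⟨P, hPc, hPI, hP, hPbot, hPtop, hPQ⟩ := exists_profile_extending hw hv hkm hk hrm hrmp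
    hvp hflux hlow (Q := fun x => Q (x - a)) (by fun_prop) (fun x => hQ0 _) (fun x => hQp _)
    (fun x hx => hle x (hx.trans (le_max_right _ _)))
    (fun x => by rw [avgVel_const_sub]; exact hQ _)
    (hQlim.comp (tendsto_atTop_add_const_right _ (-a) tendsto_id))
  have h1 := hX P ⟨hPc, hPI, hP, hPbot, hPtop⟩
  rw [hPQ X hX0] at h1
  exact h1.not_ge (hle X (le_max_left _ _))

end RoughRoad

section Flux

variable {v : ℝ → ℝ}

theorem ConcaveOn.le_tangent {S : Set ℝ} {a p : ℝ} (hv : ConcaveOn ℝ S v) (ha : a ∈ S)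
    (hp : p ∈ S) (hd : DifferentiableAt ℝ v a) : v p ≤ v a + deriv v a * (p - a) := by
  rcases lt_trichotomy a p with hap | rfl | hpa
  · have := hv.slope_le_deriv ha hp hap hd
    rw [slope_def_field, div_le_iff₀ (sub_pos.2 hap)] at this
    linarith
  · simp
  · have := hv.deriv_le_slope hp ha hpa hd
    rw [slope_def_field, le_div_iff₀ (sub_pos.2 hpa)] at this
    linarith

/-- The chord inequality for the flux `ρ ↦ ρ v(ρ)` of a concave nonincreasing velocity. -/
theorem flux_chord_le (hc : ConcaveOn ℝ (Icc 0 1) v) (ha : AntitoneOn v (Icc 0 1)) {x y z : ℝ}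
    (hx : 0 ≤ x) (hxy : x < y) (hy : y ≤ 1) (hz : z ∈ Icc x y) :
    (y - z) * (x * v x) + (z - x) * (y * v y) ≤ (y - x) * (z * v z) := by
  have hyx : 0 < y - x := sub_pos.2 hxy
  have hxI : x ∈ Icc (0:ℝ) 1 := ⟨hx, by linarith⟩
  have hyI : y ∈ Icc (0:ℝ) 1 := ⟨by linarith, hy⟩
  have hcomb : (y - z) * v x + (z - x) * v y ≤ (y - x) * v z := by
    have := hc.2 hxI hyI (div_nonneg (sub_nonneg.2 hz.2) hyx.le)
      (div_nonneg (sub_nonneg.2 hz.1) hyx.le) (by field_simp; ring)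
    have hzeq : ((y - z) / (y - x)) • x + ((z - x) / (y - x)) • y = z := by
      simp only [smul_eq_mul]
      field_simp
      ring
    rw [hzeq] at this
    simp only [smul_eq_mul] at this
    have h2 := mul_le_mul_of_nonneg_left this hyx.le
    refine le_trans (le_of_eq ?_) h2
    field_simp
  have h1 := mul_le_mul_of_nonneg_left hcomb (hx.trans hz.1)
  have h2 : 0 ≤ (y - z) * (z - x) * (v x - v y) :=
    mul_nonneg (mul_nonneg (sub_nonneg.2 hz.2) (sub_nonneg.2 hz.1))
      (sub_nonneg.2 (ha hxI hyI hxy.le))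
  linarith

end Flux

/-- **Theorem 3.4, Case D1.** For `0 < κ⁻ < κ⁺` and `ρ⁻ < ρ̂ < ρ⁺` with
`f̄ = κ⁻ρ⁻v(ρ⁻) = κ⁺ρ⁺v(ρ⁺) > 0`, there exist infinitely many continuous stationary
profiles for (M2). -/
theorem stmt_17 (h : ℝ) (hh : 0 < h) (w : ℝ → ℝ)
    (hw_supp : ∀ x, x ∉ Ico 0 h → w x = 0)
    (hw_cont : ContinuousOn w (Ico 0 h))
    (hw_bdd : ∃ Mw, ∀ x, w x ≤ Mw)
    (hw_pos : ∀ x ∈ Ioo 0 h, 0 < w x)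
    (hw_anti : StrictAntiOn w (Ioo 0 h))
    (hw_int1 : (∫ s in (0:ℝ)..h, w s) = 1)
    (v : ℝ → ℝ) (hv : ContDiffOn ℝ 2 v (Icc 0 1))
    (hv0 : v 0 = 1) (hv1 : v 1 = 0)
    (hv'neg : ∀ ρ ∈ Icc (0:ℝ) 1, deriv v ρ < 0)
    (hv''np : ∀ ρ ∈ Icc (0:ℝ) 1, deriv (deriv v) ρ ≤ 0)
    (rhohat : ℝ) (hrhohat_mem : rhohat ∈ Ioo (0:ℝ) 1)
    (hrhohat_crit : deriv (fun ρ => ρ * v ρ) rhohat = 0)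
    (hrhohat_uniq : ∀ ρ ∈ Ioo (0:ℝ) 1, deriv (fun ρ => ρ * v ρ) ρ = 0 → ρ = rhohat)
    (km kp : ℝ) (hk : 0 < km ∧ km < kp)
    (rhom rhop fbar : ℝ)
    (hrhom : rhom ∈ Ioo (0:ℝ) 1) (hrhop : rhop ∈ Ioo (0:ℝ) 1)
    (hord : rhom < rhohat ∧ rhohat < rhop)
    (hfm : fbar = km * (rhom * v rhom)) (hfp : fbar = kp * (rhop * v rhop))
    (hfpos : 0 < fbar) :
    {P : ℝ → ℝ | IsProfileM2 h w v km kp fbar rhom rhop P}.Infinite := by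
  obtain ⟨hkm, hk⟩ := hk
  have hkp : 0 < kp := hkm.trans hk
  obtain ⟨hrm0, hrm1⟩ := hrhom
  obtain ⟨hrp0, hrp1⟩ := hrhop
  obtain ⟨hh0, hh1⟩ := hrhohat_mem
  have hrmp : rhom < rhop := hord.1.trans hord.2
  have hdiff : ∀ ρ ∈ Icc (0:ℝ) 1, DifferentiableAt ℝ v ρ := fun ρ hρ =>
    differentiableAt_of_deriv_ne_zero (hv'neg ρ hρ).ne
  have hderiv : ContDiffOn ℝ 1 (deriv v) (Ioo 0 1) :=
    (hv.mono Ioo_subset_Icc_self).deriv_of_isOpen isOpen_Ioo (by norm_num)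
  have hdd : DifferentiableOn ℝ (deriv v) (Ioo 0 1) := hderiv.differentiableOn one_ne_zero
  have hanti : AntitoneOn v (Icc 0 1) :=
    antitoneOn_of_deriv_nonpos (convex_Icc 0 1) hv.continuousOn
      (fun x hx => (hdiff x (interior_subset hx)).differentiableWithinAt)
      fun x hx => (hv'neg x (interior_subset hx)).le
  have hconc : ConcaveOn ℝ (Icc 0 1) v := by
    refine concaveOn_of_deriv2_nonpos (convex_Icc 0 1) hv.continuousOn
      (fun x hx => (hdiff x (interior_subset hx)).differentiableWithinAt) ?_
      fun x hx => hv''np x (interior_subset hx)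
    rwa [interior_Icc]
  have hhI : rhohat ∈ Icc (0:ℝ) 1 := ⟨hh0.le, hh1.le⟩
  have hpI : rhop ∈ Icc (0:ℝ) 1 := ⟨hrp0.le, hrp1.le⟩
  have hvp : 0 < v rhop := by
    rw [hfp] at hfpos
    exact pos_of_mul_pos_right (pos_of_mul_pos_right hfpos hkp.le) hrp0.le
  have hcrit : v rhohat = -(rhohat * deriv v rhohat) := by
    have := (hasDerivAt_id rhohat).mul (hdiff rhohat hhI).hasDerivAt
    have h2 : deriv (fun ρ => ρ * v ρ) rhohat = 1 * v rhohat + rhohat * deriv v rhohat :=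
      this.deriv
    rw [hrhohat_crit] at h2
    linarith
  have hb : v rhop < rhop * -deriv v rhop := by
    have h1 := hconc.antitoneOn_deriv hdiff hhI hpI hord.2.le
    have h2 := hanti hhI hpI hord.2.le
    nlinarith [hv'neg rhop hpI, mul_le_mul_of_nonneg_left h1 hh0.le, hord.2]
  set u : ℝ → ℝ := fun x => v (max 0 (min 1 x)) with hu
  have huv : ∀ x ∈ Icc (0:ℝ) 1, u x = v x := fun x hx => by
    simp only [hu, min_eq_right hx.2, max_eq_right hx.1]
  have hproj : ∀ x : ℝ, max 0 (min 1 x) ∈ Icc (0:ℝ) 1 := fun x =>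
    ⟨le_max_left _ _, max_le zero_le_one (min_le_left _ _)⟩
  have huvel : IsVelocity u :=
    { cont := hv.continuousOn.comp_continuous (by fun_prop) hproj
      anti := fun x y hxy => hanti (hproj x) (hproj y) (max_le_max le_rfl (min_le_min le_rfl hxy))
      nonneg := fun x => hv1.symm.trans_le
        (hanti (hproj x) (right_mem_Icc.2 zero_le_one) (hproj x).2)
      le_one := fun x => (hanti (left_mem_Icc.2 zero_le_one) (hproj x) (hproj x).1).trans_eq hv0 }
  have hker : IsKernel h w :=
    { pos_h := hh
      pos := hw_pos
      right_eq := hw_supp h fun hmem => lt_irrefl h hmem.2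
      cont := hw_cont.mono Ioo_subset_Ico_self
      bdd := hw_bdd
      int_eq := hw_int1 }
  obtain ⟨C, hC⟩ : ∃ C, ∀ z ∈ Icc 0 rhop, |v (rhop - z) - (v rhop + -deriv v rhop * z)|
      ≤ C * z ^ 2 := by
    have hf : ContDiffOn ℝ ((1 : ℕ) + 1) (fun z => v (rhop - z)) (Icc 0 rhop) := by
      norm_num
      exact hv.comp (by fun_prop) fun z hz =>
        ⟨sub_nonneg.2 hz.2, by linarith [hz.1]⟩
    obtain ⟨C, hC⟩ := exists_taylor_mean_remainder_bound hrp0.le hf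
    refine ⟨C, fun z hz => ?_⟩
    have hd : HasDerivAt (fun z => v (rhop - z)) (-deriv v rhop) 0 := by
      have h1 : HasDerivAt v (deriv v rhop) (rhop - 0) := by
        rw [sub_zero]
        exact (hdiff rhop hpI).hasDerivAt
      exact h1.comp_const_sub rhop 0
    have h2 := hd.hasDerivWithinAt.derivWithin
      (uniqueDiffOn_Icc hrp0 0 (left_mem_Icc.2 hrp0.le))
    have h3 := hC z hz
    rw [taylorWithinEval_succ, taylor_within_zero_eval, iteratedDerivWithin_one, h2] at h3
    simp only [Real.norm_eq_abs, sub_zero, smul_eq_mul] at h3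
    norm_num at h3
    convert h3 using 3
    ring
  have hflux : km * (rhom * u rhom) = kp * (rhop * u rhop) := by
    rw [huv _ ⟨hrm0.le, hrm1.le⟩, huv _ hpI, ← hfm, ← hfp]
  have hfluxlt : rhop * v rhop < rhom * v rhom := by
    have h1 : km * (rhom * v rhom) = kp * (rhop * v rhop) := hfm.symm.trans hfp
    have h2 : km * (rhop * v rhop) < kp * (rhop * v rhop) :=
      mul_lt_mul_of_pos_right hk (mul_pos hrp0 hvp)
    exact lt_of_mul_lt_mul_left (by linarith) hkm.le
  have hinf := infinite_profiles (b := -deriv v rhop) (C := max C 0) hker huvel hkm hk hrm0 hrmp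
    (by rwa [huv _ hpI]) hflux ?_ ?_ (by rwa [huv _ hpI]) (le_max_right _ _) ?_ ?_
  · refine hinf.mono fun P hP => ?_
    obtain ⟨hPc, hPI, hP, hbot, htop⟩ := hP
    have hPI' : ∀ x, P x ∈ Icc (0:ℝ) 1 := fun x => ⟨(hPI x).1, (hPI x).2.trans hrp1.le⟩
    refine ⟨hPc, hPI', fun x => ?_, hbot, htop⟩
    rw [hfp, ← huv _ hpI, ← hP x]
    simp only [avgVel, huv _ (hPI' _)]
  · intro l hl hle
    rw [huv _ ⟨hrm0.le, hrm1.le⟩, huv _ ⟨hl.1, hl.2.trans hrm1.le⟩] at hle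
    by_contra hne
    have hlt : l < rhom := lt_of_le_of_ne hl.2 hne
    have hlI : l ∈ Icc (0:ℝ) 1 := ⟨hl.1, hl.2.trans hrm1.le⟩
    have h1 := flux_chord_le hconc hanti hl.1 (hlt.trans hord.1) hh1.le ⟨hlt.le, hord.1.le⟩
    have h2 : l * v l < rhohat * v rhohat := by
      have h3 := mul_le_mul_of_nonneg_left (hconc.le_tangent hhI hlI (hdiff _ hhI)) hl.1
      have h4 : 0 < -deriv v rhohat * (rhohat - l) ^ 2 :=
        mul_pos (neg_pos.2 (hv'neg _ hhI)) (pow_pos (by linarith [hord.1]) 2)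
      rw [hcrit] at h3 ⊢
      linarith
    nlinarith [mul_lt_mul_of_pos_left h2 (sub_pos.2 hlt),
      mul_le_mul_of_nonneg_left hle (sub_pos.2 (hlt.trans hord.1)).le]
  · intro q hq
    rw [huv _ hpI, huv _ ⟨hrm0.le.trans hq.1, hq.2.le.trans hrp1.le⟩]
    have h1 := flux_chord_le hconc hanti hrm0.le hrmp hrp1.le ⟨hq.1, hq.2.le⟩
    have h2 := mul_lt_mul_of_pos_left hfluxlt (sub_pos.2 hq.2)
    exact lt_of_mul_lt_mul_left (by linarith) (sub_pos.2 hrmp).le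
  · intro p hp
    have hpI' : p ∈ Icc (0:ℝ) 1 := ⟨hp.1, hp.2.trans hrp1.le⟩
    rw [huv _ hpI, huv _ hpI']
    linarith [hconc.le_tangent hpI hpI' (hdiff _ hpI)]
  · intro z hz
    rw [huv _ hpI, huv _ ⟨sub_nonneg.2 hz.2, by linarith [hz.1]⟩]
    have h1 := (abs_le.1 (hC z hz)).1
    have h2 := mul_le_mul_of_nonneg_right (le_max_left C 0) (sq_nonneg z)
    linarith
end

section
/- (Unique solvability of the backward discretization step.) Let v and w be as in the context. Fix Δx > 0, x₀ ∈ ℝ, ρ̄ ∈ (0,1), and let Q : [x₀,∞) → (0, ρ̄] be continuous and monotone nondecreasing. For q ∈ [0, Q(x₀)] define Q_q : [x₀−Δx, ∞) → ℝ by Q_q(x) = Q(x) for x ≥ x₀ and Q_q(x) = q·(x₀−x)/Δx + Q(x₀)·(x−x₀+Δx)/Δx for x ∈ [x₀−Δx, x₀] (linear interpolation from q to Q(x₀)), and set G(q) := q·v(∫₀^h Q_q(x₀−Δx+s)·w(s) ds) − Q(x₀)·v(∫₀^h Q(x₀+s)·w(s) ds). If Δx·w(0)·max_{ρ∈[0,1]}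 |v'(ρ)| < 2·v(ρ̄), then G(0) < 0, G(Q(x₀)) ≥ 0, and G is strictly increasing on [0, Q(x₀)]; consequently G has a unique root q* and q* ∈ (0, Q(x₀)]. -/
open Set Filter Topology MeasureTheory

/-- The backward extension of `Q` by linear interpolation: `Qmod x₀ Δx q Q` agrees with `Q`
on `[x₀,∞)` and, on `[x₀−Δx, x₀]`, interpolates linearly from the value `q` at `x₀−Δx` to
`Q(x₀)` at `x₀`. -/
noncomputable def Qmod (x0 dx q : ℝ) (Q : ℝ → ℝ) : ℝ → ℝ :=
  fun x => if x0 ≤ x then Q x else q * ((x0 - x) / dx) + Q x0 * ((x - x0 + dx) / dx)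

/-- The function of the backward discretization step:
`G(q) = q·v(A(Q_q; x₀−Δx)) − Q(x₀)·v(A(Q; x₀))`. -/
noncomputable def Gfun (h : ℝ) (w v : ℝ → ℝ) (x0 dx : ℝ) (Q : ℝ → ℝ) (q : ℝ) : ℝ :=
  q * v (∫ s in (0:ℝ)..h, Qmod x0 dx q Q (x0 - dx + s) * w s)
    - Q x0 * v (∫ s in (0:ℝ)..h, Q (x0 + s) * w s)

/-- A function continuous from the right at `0` and antitone on `(0,h)` is bounded by its value
at `0`. -/
theorem le_apply_zero_of_antitoneOn {h : ℝ} {w : ℝ → ℝ}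
    (hw_cont : ContinuousOn w (Ico 0 h)) (hw_anti : AntitoneOn w (Ioo 0 h))
    {s : ℝ} (hs : s ∈ Ioo 0 h) : w s ≤ w 0 := by
  have hcont : ContinuousWithinAt w (Ioo 0 s) 0 :=
    (hw_cont 0 ⟨le_rfl, hs.1.trans hs.2⟩).mono fun t ht => ⟨ht.1.le, ht.2.trans hs.2⟩
  have hlim : Tendsto w (𝓝[>] 0) (𝓝 (w 0)) := by
    rw [← nhdsWithin_Ioo_eq_nhdsGT hs.1]
    exact hcont
  refine ge_of_tendsto hlim ?_
  filter_upwards [Ioo_mem_nhdsGT hs.1] with t ht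
  exact hw_anti ⟨ht.1, ht.2.trans hs.2⟩ hs ht.2.le

/-- The hat function `s ↦ max 0 ((d - s) / d)` has mass at most `d / 2` on `[0,h]`. -/
theorem integral_max_zero_sub_div_le {h d : ℝ} (hh : 0 ≤ h) (hd : 0 < d) :
    ∫ s in (0:ℝ)..h, max 0 ((d - s) / d) ≤ d / 2 := by
  have hcont : Continuous fun s : ℝ => max 0 ((d - s) / d) := by fun_prop
  have hext : ∫ s in (0:ℝ)..h, max 0 ((d - s) / d) ≤
      ∫ s in (0:ℝ)..max h d, max 0 ((d - s) / d) :=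
    intervalIntegral.integral_mono_interval le_rfl hh (le_max_left h d)
      (Eventually.of_forall fun s => le_max_left _ _) (hcont.intervalIntegrable _ _)
  refine hext.trans_eq ?_
  rw [← intervalIntegral.integral_add_adjacent_intervals (hcont.intervalIntegrable 0 d)
    (hcont.intervalIntegrable d _)]
  have hleft : ∫ s in (0:ℝ)..d, max 0 ((d - s) / d) = ∫ s in (0:ℝ)..d, (d - s) / d := by
    refine intervalIntegral.integral_congr fun s hs => ?_
    rw [uIcc_of_le hd.le] at hs
    exact max_eq_right (div_nonneg (sub_nonneg.2 hs.2) hd.le)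
  have hright : ∫ s in d..max h d, max 0 ((d - s) / d) = ∫ _ in d..max h d, (0:ℝ) := by
    refine intervalIntegral.integral_congr fun s hs => ?_
    rw [uIcc_of_le (le_max_right h d)] at hs
    exact max_eq_left (div_nonpos_of_nonpos_of_nonneg (sub_nonpos.2 hs.1) hd.le)
  rw [hleft, hright, intervalIntegral.integral_div,
    intervalIntegral.integral_sub (by simp) (by simp)]
  simp only [intervalIntegral.integral_const, integral_id, smul_eq_mul,
    intervalIntegral.integral_zero]
  field_simp
  ring

/-- `Qmod` as a constant extension of `Q` plus a multiple of a hat function. -/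
theorem Qmod_eq_add_mul_max {x0 dx : ℝ} (hdx : 0 < dx) (q : ℝ) (Q : ℝ → ℝ) (s : ℝ) :
    Qmod x0 dx q Q (x0 - dx + s) =
      Q (max x0 (x0 - dx + s)) + (q - Q x0) * max 0 ((dx - s) / dx) := by
  unfold Qmod
  split_ifs with hs
  · rw [max_eq_right hs, max_eq_left (div_nonpos_of_nonpos_of_nonneg (by linarith) hdx.le)]
    ring
  · rw [max_eq_left (not_le.1 hs).le, max_eq_right (div_nonneg (by linarith) hdx.le)]
    field_simp
    ring

/-- Averages against a nonnegative weight are monotone. -/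
theorem integral_mul_mono_of_nonneg {h : ℝ} (hh : 0 ≤ h) {w f g : ℝ → ℝ}
    (hw : ∀ s ∈ Ioo 0 h, 0 ≤ w s) (hwi : IntervalIntegrable w volume 0 h)
    (hf : ContinuousOn f (Icc 0 h)) (hg : ContinuousOn g (Icc 0 h))
    (hfg : ∀ s ∈ Ioo 0 h, f s ≤ g s) :
    ∫ s in (0:ℝ)..h, f s * w s ≤ ∫ s in (0:ℝ)..h, g s * w s := by
  rw [← uIcc_of_le hh] at hf hg
  exact intervalIntegral.integral_mono_on_of_le_Ioo hh (hwi.continuousOn_mul hf)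
    (hwi.continuousOn_mul hg) fun s hs => mul_le_mul_of_nonneg_right (hfg s hs) (hw s hs)

/-- **unique solvability of the backward discretization step.** Under the
smallness condition `Δx·w(0)·max|v'| < 2·v(ρ̄)`, one has `G(0) < 0`, `G(Q(x₀)) ≥ 0`, and
`G` is strictly increasing on `[0, Q(x₀)]`; consequently `G` has a unique root `q*` there,
and `q* ∈ (0, Q(x₀)]`. -/
theorem stmt_19 (h : ℝ) (hh : 0 < h) (w : ℝ → ℝ)
    (hw_supp : ∀ x, x ∉ Ico 0 h → w x = 0)
    (hw_cont : ContinuousOn w (Ico 0 h))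
    (hw_bdd : ∃ Mw, ∀ x, w x ≤ Mw)
    (hw_pos : ∀ x ∈ Ioo 0 h, 0 < w x)
    (hw_anti : StrictAntiOn w (Ioo 0 h))
    (hw_int1 : (∫ s in (0:ℝ)..h, w s) = 1)
    (v : ℝ → ℝ) (hv : ContDiffOn ℝ 2 v (Icc 0 1))
    (hv0 : v 0 = 1) (hv1 : v 1 = 0)
    (hv'neg : ∀ ρ ∈ Icc (0:ℝ) 1, deriv v ρ < 0)
    (hv''np : ∀ ρ ∈ Icc (0:ℝ) 1, deriv (deriv v) ρ ≤ 0)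
    (dx : ℝ) (hdx : 0 < dx) (x0 : ℝ)
    (rhobar : ℝ) (hrhobar : rhobar ∈ Ioo (0:ℝ) 1)
    (Q : ℝ → ℝ)
    (hQr : ∀ x ≥ x0, Q x ∈ Ioc (0:ℝ) rhobar)
    (hQc : ContinuousOn Q (Ici x0))
    (hQmono : MonotoneOn Q (Ici x0))
    (Mv : ℝ) (hMv : ∀ ρ ∈ Icc (0:ℝ) 1, |deriv v ρ| ≤ Mv)
    (hsmall : dx * w 0 * Mv < 2 * v rhobar) :
    Gfun h w v x0 dx Q 0 < 0 ∧
    0 ≤ Gfun h w v x0 dx Q (Q x0) ∧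
    StrictMonoOn (Gfun h w v x0 dx Q) (Icc 0 (Q x0)) ∧
    ∃ qstar : ℝ, (qstar ∈ Ioc (0:ℝ) (Q x0) ∧ Gfun h w v x0 dx Q qstar = 0) ∧
      ∀ q ∈ Icc (0:ℝ) (Q x0), Gfun h w v x0 dx Q q = 0 → q = qstar := by
  have hwnn : ∀ s ∈ Ioo 0 h, 0 ≤ w s := fun s hs => (hw_pos s hs).le
  have hwle : ∀ s ∈ Ioo 0 h, w s ≤ w 0 := fun s hs =>
    le_apply_zero_of_antitoneOn hw_cont hw_anti.antitoneOn hs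
  have hw0 : 0 ≤ w 0 := (hwnn (h / 2) ⟨by linarith, by linarith⟩).trans
    (hwle (h / 2) ⟨by linarith, by linarith⟩)
  have hwi : IntervalIntegrable w volume 0 h := by
    by_contra hni
    rw [intervalIntegral.integral_undef hni] at hw_int1
    exact zero_ne_one hw_int1
  have hvd : ∀ ρ ∈ Icc (0:ℝ) 1, DifferentiableAt ℝ v ρ := fun ρ hρ =>
    differentiableAt_of_deriv_ne_zero (hv'neg ρ hρ).ne
  have hvc : ContinuousOn v (Icc 0 1) := hv.continuousOn
  have hvanti : StrictAntiOn v (Icc 0 1) :=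
    strictAntiOn_of_deriv_neg (convex_Icc 0 1) hvc fun ρ hρ => hv'neg ρ (interior_subset hρ)
  have hvlip : ∀ a ∈ Icc (0:ℝ) 1, ∀ b ∈ Icc (0:ℝ) 1, a ≤ b → v a - v b ≤ Mv * (b - a) := by
    intro a ha b hb hab
    have hnorm := (convex_Icc (0:ℝ) 1).norm_image_sub_le_of_norm_deriv_le hvd hMv ha hb
    rw [Real.norm_eq_abs, Real.norm_eq_abs, abs_of_nonneg (sub_nonneg.2 hab)] at hnorm
    linarith [neg_abs_le (v b - v a)]
  have hMv0 : 0 ≤ Mv := (abs_nonneg _).trans (hMv 0 (by simp))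
  obtain ⟨hr0, hr1⟩ := hrhobar
  have hrmem : rhobar ∈ Icc (0:ℝ) 1 := ⟨hr0.le, hr1.le⟩
  have hvr : 0 < v rhobar := hv1 ▸ hvanti hrmem (by simp) hr1
  have hvge : ∀ a ∈ Icc 0 rhobar, v rhobar ≤ v a := fun a ha =>
    hvanti.antitoneOn ⟨ha.1, ha.2.trans hr1.le⟩ hrmem ha.2
  obtain ⟨hQ0, hQ0r⟩ := hQr x0 le_rfl
  set k : ℝ → ℝ := fun s => max 0 ((dx - s) / dx) with hk
  set E : ℝ → ℝ := fun s => Q (max x0 (x0 - dx + s)) with hE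
  have hkc : Continuous k := by fun_prop
  have hEc : Continuous E := hQc.comp_continuous (by fun_prop) fun s => mem_Ici.2 (le_max_left _ _)
  have hk0 : ∀ s, 0 ≤ k s := fun s => le_max_left _ _
  have hk1 : ∀ s ∈ Ioo 0 h, k s ≤ 1 := fun s hs =>
    max_le zero_le_one ((div_le_one hdx).2 (by linarith [hs.1]))
  have hEge : ∀ s, Q x0 ≤ E s := fun s =>
    hQmono (mem_Ici.2 le_rfl) (mem_Ici.2 (le_max_left _ _)) (le_max_left _ _)
  have hEle : ∀ s, E s ≤ rhobar := fun s => (hQr _ (le_max_left _ _)).2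
  have hQs : ContinuousOn (fun s => Q (x0 + s)) (Icc 0 h) :=
    hQc.comp (by fun_prop) fun s hs => by simpa using hs.1
  have havg : ∀ f : ℝ → ℝ, ContinuousOn f (Icc 0 h) → (∀ s ∈ Ioo 0 h, f s ∈ Icc 0 rhobar) →
      ∫ s in (0:ℝ)..h, f s * w s ∈ Icc 0 rhobar := by
    intro f hf hfr
    constructor
    · simpa using integral_mul_mono_of_nonneg hh.le hwnn hwi continuousOn_const hf
        fun s hs => (hfr s hs).1
    · simpa [hw_int1] using integral_mul_mono_of_nonneg hh.le hwnn hwi hf continuousOn_const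
        fun s hs => (hfr s hs).2
  set A : ℝ → ℝ := fun q => ∫ s in (0:ℝ)..h, Qmod x0 dx q Q (x0 - dx + s) * w s with hA
  set A0 : ℝ := ∫ s in (0:ℝ)..h, Q (x0 + s) * w s with hA0
  set B : ℝ := ∫ s in (0:ℝ)..h, k s * w s with hB
  have hAE : ∀ q, A q = ∫ s in (0:ℝ)..h, (E s + (q - Q x0) * k s) * w s := fun q => by
    simp only [hA, Qmod_eq_add_mul_max hdx, hE, hk]
  have hAaff : ∀ q, A q = (∫ s in (0:ℝ)..h, E s * w s) + (q - Q x0) * B := by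
    intro q
    rw [hAE, hB, ← intervalIntegral.integral_const_mul, ← intervalIntegral.integral_add
      (hwi.continuousOn_mul hEc.continuousOn)
      ((hwi.continuousOn_mul hkc.continuousOn).const_mul _)]
    exact intervalIntegral.integral_congr fun s _ => by ring
  have hB0 : 0 ≤ B := by
    simpa using integral_mul_mono_of_nonneg hh.le hwnn hwi continuousOn_const
      hkc.continuousOn fun s _ => hk0 s
  have hBle : B ≤ dx / 2 * w 0 := by
    have hmono : B ≤ ∫ s in (0:ℝ)..h, k s * w 0 :=
      intervalIntegral.integral_mono_on_of_le_Ioo hh.le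
        (hwi.continuousOn_mul hkc.continuousOn)
        ((hkc.mul continuous_const).intervalIntegrable _ _)
        fun s hs => mul_le_mul_of_nonneg_left (hwle s hs) (hk0 s)
    rw [intervalIntegral.integral_mul_const] at hmono
    exact hmono.trans (mul_le_mul_of_nonneg_right (integral_max_zero_sub_div_le hh.le hdx) hw0)
  have hAmem : ∀ q ∈ Icc 0 (Q x0), A q ∈ Icc 0 rhobar := by
    intro q hq
    rw [hAE]
    refine havg _ (by fun_prop) fun s hs => ⟨?_, ?_⟩
    · nlinarith [hEge s, hk0 s, hk1 s hs, mul_nonneg hq.1 (hk0 s)]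
    · nlinarith [hEle s, mul_nonneg (sub_nonneg.2 hq.2) (hk0 s)]
  have hA0mem : A0 ∈ Icc 0 rhobar := havg _ hQs fun s hs =>
    let hQxs := hQr (x0 + s) (by linarith [hs.1])
    ⟨hQxs.1.le, hQxs.2⟩
  have hunit : Icc 0 rhobar ⊆ Icc (0:ℝ) 1 := Icc_subset_Icc_right hr1.le
  have hG : ∀ q, Gfun h w v x0 dx Q q = q * v (A q) - Q x0 * v A0 := fun q => rfl
  have hneg : Gfun h w v x0 dx Q 0 < 0 := by
    rw [hG]
    nlinarith [mul_pos hQ0 (hvr.trans_le (hvge A0 hA0mem))]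
  have hnonneg : 0 ≤ Gfun h w v x0 dx Q (Q x0) := by
    have hQmem : Q x0 ∈ Icc 0 (Q x0) := ⟨hQ0.le, le_rfl⟩
    have hle : A (Q x0) ≤ A0 := by
      rw [hAaff, sub_self, zero_mul, add_zero]
      exact integral_mul_mono_of_nonneg hh.le hwnn hwi hEc.continuousOn hQs fun s hs =>
        hQmono (mem_Ici.2 (le_max_left _ _)) (mem_Ici.2 (by linarith [hs.1]))
          (max_le (by linarith [hs.1]) (by linarith))
    rw [hG, ← mul_sub]
    exact mul_nonneg hQ0.le (sub_nonneg.2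
      (hvanti.antitoneOn (hunit (hAmem _ hQmem)) (hunit hA0mem) hle))
  have hmono : StrictMonoOn (Gfun h w v x0 dx Q) (Icc 0 (Q x0)) := by
    intro p hp q hq hpq
    have hAsub : A q - A p = (q - p) * B := by rw [hAaff, hAaff]; ring
    have hAle : A p ≤ A q := sub_nonneg.1 (hAsub ▸ mul_nonneg (sub_pos.2 hpq).le hB0)
    have hlip := hvlip _ (hunit (hAmem p hp)) _ (hunit (hAmem q hq)) hAle
    rw [hAsub] at hlip
    have hslope : p * (Mv * B) < v rhobar := by
      have hp1 : p ≤ 1 := hp.2.trans (hQ0r.trans hr1.le)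
      have hMB : Mv * B ≤ Mv * (dx / 2 * w 0) := mul_le_mul_of_nonneg_left hBle hMv0
      have hpMB : p * (Mv * B) ≤ Mv * B := mul_le_of_le_one_left (mul_nonneg hMv0 hB0) hp1
      linarith
    rw [hG, hG]
    have hfirst := mul_le_mul_of_nonneg_left (hvge _ (hAmem q hq)) (sub_pos.2 hpq).le
    have hsecond := mul_le_mul_of_nonneg_left hlip hp.1
    have hgap := mul_pos (sub_pos.2 hpq) (sub_pos.2 hslope)
    linarith
  refine ⟨hneg, hnonneg, hmono, ?_⟩
  have hAc : Continuous A := by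
    rw [funext hAaff]
    fun_prop
  have hGc : ContinuousOn (Gfun h w v x0 dx Q) (Icc 0 (Q x0)) := by
    rw [funext hG]
    exact (continuousOn_id.mul (hvc.comp hAc.continuousOn fun q hq => hunit (hAmem q hq))).sub
      continuousOn_const
  obtain ⟨r, hr, hr_root⟩ := intermediate_value_Icc hQ0.le hGc ⟨hneg.le, hnonneg⟩
  have hr_pos : 0 < r := hr.1.lt_of_ne fun h0 => hneg.ne (h0 ▸ hr_root)
  exact ⟨r, ⟨⟨hr_pos, hr.2⟩, hr_root⟩, fun q hq hq_root =>
    hmono.injOn hq hr (hq_root.trans hr_root.symm)⟩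
end
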